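/- arXiv:2605.10288 — 8 statements merged into one kernel-verified Lean document; each statement's English description precedes it below -/
import Mathlib

section
/- Let m and r be integers with 1 ≤ r ≤ m, let P be a scaled Haar projector and Q := P Pᵀ. Then: (a) for every fixed U ∈ ℝ^{r×n}, almost surely ‖P U‖² = (m/r)·‖U‖²; (b) for every fixed Z ∈ ℝ^{m×n}, E[‖Pᵀ Z‖²] = ‖Z‖² and E[‖(Q − I_m) Z‖²] = (m/r − 1)·‖Z‖². -/
open MeasureTheory Matrix

/-- Matrices carry the product σ-algebra (entrywise). -/
instance matrixMeasurableSpace {m n : ℕ} : MeasurableSpace (Matrix (Fin m) (Fin n) ℝ) :=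
  inferInstanceAs (MeasurableSpace (Fin m → Fin n → ℝ))

/-- Squared Frobenius norm of a real matrix. -/
def frobSq {k l : ℕ} (X : Matrix (Fin k) (Fin l) ℝ) : ℝ := ∑ i, ∑ j, (X i j) ^ 2

/-- The squared Frobenius norm is the trace of the Gram matrix. -/
lemma frobSq_eq_trace {k l : ℕ} (X : Matrix (Fin k) (Fin l) ℝ) : frobSq X = (Xᵀ * X).trace := by
  simp only [frobSq, Matrix.trace, Matrix.diag_apply, Matrix.mul_apply, Matrix.transpose_apply, sq]
  exact Finset.sum_comm

lemma frobSq_mul_of_gram {k l n : ℕ} {A : Matrix (Fin k) (Fin l) ℝ} {c : ℝ}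
    (hA : Aᵀ * A = c • (1 : Matrix (Fin l) (Fin l) ℝ)) (U : Matrix (Fin l) (Fin n) ℝ) :
    frobSq (A * U) = c * frobSq U := by
  have h : (A * U)ᵀ * (A * U) = c • (Uᵀ * U) := by
    rw [Matrix.transpose_mul, Matrix.mul_assoc, ← Matrix.mul_assoc Aᵀ, hA, Matrix.smul_mul,
      Matrix.one_mul, Matrix.mul_smul]
  rw [frobSq_eq_trace, frobSq_eq_trace, h, Matrix.trace_smul, smul_eq_mul]

lemma frobSq_mul_transpose_sub_one_mul_of_gram {k l n : ℕ} {A : Matrix (Fin k) (Fin l) ℝ} {c : ℝ}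
    (hA : Aᵀ * A = c • (1 : Matrix (Fin l) (Fin l) ℝ)) (Z : Matrix (Fin k) (Fin n) ℝ) :
    frobSq ((A * Aᵀ - 1) * Z) = (c - 2) * frobSq (Aᵀ * Z) + frobSq Z := by
  have h : ((A * Aᵀ - 1) * Z)ᵀ * ((A * Aᵀ - 1) * Z)
      = (c - 2) • ((Aᵀ * Z)ᵀ * (Aᵀ * Z)) + Zᵀ * Z := by
    have h1 : (A * Aᵀ - 1)ᵀ * (A * Aᵀ - 1) = (c - 2) • (A * Aᵀ) + 1 := by
      have h2 : A * Aᵀ * (A * Aᵀ) = c • (A * Aᵀ) := by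
        rw [Matrix.mul_assoc, ← Matrix.mul_assoc Aᵀ, hA, Matrix.smul_mul, Matrix.one_mul,
          Matrix.mul_smul]
      rw [Matrix.transpose_sub, Matrix.transpose_mul, Matrix.transpose_transpose,
        Matrix.transpose_one, Matrix.sub_mul, Matrix.mul_sub, h2]
      simp only [Matrix.mul_one, Matrix.one_mul, sub_smul, two_smul]
      abel
    rw [Matrix.transpose_mul, Matrix.mul_assoc, ← Matrix.mul_assoc _ (A * Aᵀ - 1), h1]
    simp only [Matrix.transpose_mul, Matrix.transpose_transpose, Matrix.add_mul, Matrix.mul_add,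
      Matrix.smul_mul, Matrix.mul_smul, Matrix.one_mul, Matrix.mul_assoc]
  rw [frobSq_eq_trace, frobSq_eq_trace, frobSq_eq_trace, h, Matrix.trace_add, Matrix.trace_smul,
    smul_eq_mul]

lemma measurable_entry {k l : ℕ} (i : Fin k) (j : Fin l) :
    Measurable fun X : Matrix (Fin k) (Fin l) ℝ => X i j :=
  (measurable_pi_apply j).comp (measurable_pi_apply i)

lemma measurable_const_mul_matrix {k l n : ℕ} (g : Matrix (Fin k) (Fin l) ℝ) :
    Measurable fun X : Matrix (Fin l) (Fin n) ℝ => g * X := by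
  refine measurable_pi_lambda _ fun i => measurable_pi_lambda _ fun j => ?_
  simp only [Matrix.mul_apply]
  exact Finset.measurable_fun_sum _ fun a _ => (measurable_entry a j).const_mul _

lemma abs_entry_le_one_of_transpose_mul_self {m : ℕ} {A : Matrix (Fin m) (Fin m) ℝ}
    (hA : Aᵀ * A = 1) (i j : Fin m) : |A i j| ≤ 1 := by
  have h := congrFun (congrFun hA j) j
  simp only [Matrix.mul_apply, Matrix.transpose_apply, Matrix.one_apply_eq, ← sq] at h
  have := Finset.single_le_sum (f := fun a => A a j ^ 2) (fun a _ => sq_nonneg _)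
    (Finset.mem_univ i)
  exact abs_le_one_iff_mul_self_le_one.2 (by simp only [h] at this; nlinarith)

section Haar

variable {m : ℕ} {Ω : Type*} [MeasurableSpace Ω] {μ : Measure Ω}
  {O : Ω → Matrix (Fin m) (Fin m) ℝ}

lemma integral_comp_mul_left_of_invariant (hOmeas : Measurable O) {g : Matrix (Fin m) (Fin m) ℝ}
    (hg : Measure.map (fun ω => g * O ω) μ = Measure.map O μ)
    {f : Matrix (Fin m) (Fin m) ℝ → ℝ} (hf : Measurable f) :
    ∫ ω, f (g * O ω) ∂μ = ∫ ω, f (O ω) ∂μ := by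
  have hgO : Measurable fun ω => g * O ω := (measurable_const_mul_matrix g).comp hOmeas
  rw [← integral_map hOmeas.aemeasurable hf.aestronglyMeasurable, ← hg,
    integral_map hgO.aemeasurable hf.aestronglyMeasurable]

lemma integrable_entry_mul_entry [IsProbabilityMeasure μ] (hOmeas : Measurable O)
    (hOorth : ∀ᵐ ω ∂μ, (O ω)ᵀ * O ω = 1) (i j k l : Fin m) :
    Integrable (fun ω => O ω i k * O ω j l) μ := by
  refine Integrable.of_bound (C := 1) (((measurable_entry i k).comp hOmeas).mul
    ((measurable_entry j l).comp hOmeas)).aestronglyMeasurable ?_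
  filter_upwards [hOorth] with ω hω
  rw [Real.norm_eq_abs, abs_mul]
  exact mul_le_one₀ (abs_entry_le_one_of_transpose_mul_self hω i k) (abs_nonneg _)
    (abs_entry_le_one_of_transpose_mul_self hω j l)

lemma integral_entry_mul_entry_of_ne (hOmeas : Measurable O)
    (hOhaar : ∀ g : Matrix (Fin m) (Fin m) ℝ, gᵀ * g = 1 →
      Measure.map (fun ω => g * O ω) μ = Measure.map O μ) {i j : Fin m} (hij : i ≠ j)
    (k l : Fin m) : ∫ ω, O ω i k * O ω j l ∂μ = 0 := by
  let d : Fin m → ℝ := fun a => if a = i then -1 else 1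
  have hd : (Matrix.diagonal d)ᵀ * Matrix.diagonal d = 1 := by
    rw [Matrix.diagonal_transpose, Matrix.diagonal_mul_diagonal, ← Matrix.diagonal_one]
    congr 1
    ext a
    by_cases h : a = i <;> simp [d, h]
  have h := integral_comp_mul_left_of_invariant hOmeas (hOhaar _ hd)
    (f := fun X => X i k * X j l) ((measurable_entry i k).mul (measurable_entry j l))
  simp only [Matrix.diagonal_mul, d, if_true, if_neg hij.symm, neg_mul, one_mul,
    integral_neg] at h
  linarith

lemma integral_entry_sq [IsProbabilityMeasure μ] (hOmeas : Measurable O)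
    (hOorth : ∀ᵐ ω ∂μ, (O ω)ᵀ * O ω = 1)
    (hOhaar : ∀ g : Matrix (Fin m) (Fin m) ℝ, gᵀ * g = 1 →
      Measure.map (fun ω => g * O ω) μ = Measure.map O μ) (i k : Fin m) :
    ∫ ω, O ω i k * O ω i k ∂μ = (m : ℝ)⁻¹ := by
  have hrow (j : Fin m) : ∫ ω, O ω j k * O ω j k ∂μ = ∫ ω, O ω i k * O ω i k ∂μ := by
    have hmul (X : Matrix (Fin m) (Fin m) ℝ) :
        (Equiv.swap i j).toPEquiv.toMatrix * X = X.submatrix (Equiv.swap i j) id :=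
      PEquiv.toMatrix_toPEquiv_mul _ _
    have hg : ((Equiv.swap i j).toPEquiv.toMatrix : Matrix (Fin m) (Fin m) ℝ)ᵀ
        * (Equiv.swap i j).toPEquiv.toMatrix = 1 := by
      rw [← PEquiv.toMatrix_symm, ← PEquiv.toMatrix_trans, ← Equiv.toPEquiv_symm,
        ← Equiv.toPEquiv_trans]
      simp
    have h := integral_comp_mul_left_of_invariant hOmeas (hOhaar _ hg)
      (f := fun X => X i k * X i k) ((measurable_entry i k).mul (measurable_entry i k))
    simpa only [hmul, Matrix.submatrix_apply, Equiv.swap_apply_left, id] using h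
  have hsum : ∑ j, ∫ ω, O ω j k * O ω j k ∂μ = 1 := by
    rw [← integral_finsetSum _ fun j _ => integrable_entry_mul_entry hOmeas hOorth j j k k]
    have : (fun ω => ∑ j, O ω j k * O ω j k) =ᵐ[μ] fun _ => (1 : ℝ) := by
      filter_upwards [hOorth] with ω hω
      simpa [Matrix.mul_apply] using congrFun (congrFun hω k) k
    simp [integral_congr_ae this]
  simp only [hrow, Finset.sum_const, Finset.card_univ, Fintype.card_fin, nsmul_eq_mul] at hsum
  exact eq_inv_of_mul_eq_one_right hsum

lemma integral_entry_mul_entry [IsProbabilityMeasure μ] (hOmeas : Measurable O)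
    (hOorth : ∀ᵐ ω ∂μ, (O ω)ᵀ * O ω = 1)
    (hOhaar : ∀ g : Matrix (Fin m) (Fin m) ℝ, gᵀ * g = 1 →
      Measure.map (fun ω => g * O ω) μ = Measure.map O μ) (i j k : Fin m) :
    ∫ ω, O ω i k * O ω j k ∂μ = if i = j then (m : ℝ)⁻¹ else 0 := by
  split_ifs with h
  · rw [← h]
    exact integral_entry_sq hOmeas hOorth hOhaar i k
  · exact integral_entry_mul_entry_of_ne hOmeas hOhaar h k k

end Haar

lemma frobSq_transpose_mul {k l n : ℕ} (A : Matrix (Fin k) (Fin l) ℝ)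
    (Z : Matrix (Fin k) (Fin n) ℝ) :
    frobSq (Aᵀ * Z) = ∑ a, ∑ b, ∑ i, ∑ j, A i a * A j a * (Z i b * Z j b) := by
  simp only [frobSq, Matrix.mul_apply, Matrix.transpose_apply, sq, Finset.sum_mul_sum]
  refine Finset.sum_congr rfl fun a _ => Finset.sum_congr rfl fun b _ =>
    Finset.sum_congr rfl fun i _ => Finset.sum_congr rfl fun j _ => by ring

lemma frobSq_smul {k l : ℕ} (c : ℝ) (X : Matrix (Fin k) (Fin l) ℝ) :
    frobSq (c • X) = c ^ 2 * frobSq X := by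
  simp only [frobSq, Matrix.smul_apply, smul_eq_mul, mul_pow, Finset.mul_sum]

/-- For integers `1 ≤ r ≤ m`, let `P` be a scaled Haar projector and
`Q := P * Pᵀ`. Then (a) for every fixed `U ∈ ℝ^{r×n}`, almost surely
`‖P U‖² = (m/r)·‖U‖²` (Frobenius norms); (b) for every fixed `Z ∈ ℝ^{m×n}`,
`E[‖Pᵀ Z‖²] = ‖Z‖²` and `E[‖(Q − I) Z‖²] = (m/r − 1)·‖Z‖²`. -/
theorem stmt1
    (m r n : ℕ) (hr : 1 ≤ r) (hrm : r ≤ m)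
    {Ω : Type} [MeasurableSpace Ω] (μ : Measure Ω) [IsProbabilityMeasure μ]
    (O : Ω → Matrix (Fin m) (Fin m) ℝ) (hOmeas : Measurable O)
    (hOorth : ∀ᵐ ω ∂μ, (O ω)ᵀ * O ω = 1)
    (hOhaar : ∀ g : Matrix (Fin m) (Fin m) ℝ, gᵀ * g = 1 →
      Measure.map (fun ω => g * O ω) μ = Measure.map O μ)
    (P : Ω → Matrix (Fin m) (Fin r) ℝ)
    (hP : ∀ ω, P ω = Real.sqrt ((m : ℝ) / r) • (O ω).submatrix id (Fin.castLE hrm))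
    (Q : Ω → Matrix (Fin m) (Fin m) ℝ)
    (hQ : ∀ ω, Q ω = P ω * (P ω)ᵀ) :
    (∀ U : Matrix (Fin r) (Fin n) ℝ,
      ∀ᵐ ω ∂μ, frobSq (P ω * U) = ((m : ℝ) / r) * frobSq U) ∧
    (∀ Z : Matrix (Fin m) (Fin n) ℝ,
      (∫ ω, frobSq ((P ω)ᵀ * Z) ∂μ = frobSq Z) ∧
      (∫ ω, frobSq ((Q ω - 1) * Z) ∂μ = ((m : ℝ) / r - 1) * frobSq Z)) := by
  have hm0 : (m : ℝ) ≠ 0 := by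
    have : 0 < m := by omega
    positivity
  have hr0 : (r : ℝ) ≠ 0 := by positivity
  have hsqrt : Real.sqrt ((m : ℝ) / r) ^ 2 = (m : ℝ) / r := Real.sq_sqrt (by positivity)
  have hgram : ∀ᵐ ω ∂μ, (P ω)ᵀ * P ω = ((m : ℝ) / r) • (1 : Matrix (Fin r) (Fin r) ℝ) := by
    filter_upwards [hOorth] with ω hω
    have hsub : ((O ω).submatrix id (Fin.castLE hrm))ᵀ * (O ω).submatrix id (Fin.castLE hrm)
        = 1 := by
      rw [Matrix.transpose_submatrix, ← Matrix.submatrix_mul _ _ _ _ _ Function.bijective_id, hω,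
        Matrix.submatrix_one _ (Fin.castLE_injective hrm)]
    rw [hP, Matrix.transpose_smul, Matrix.smul_mul, Matrix.mul_smul, hsub, smul_smul, ← sq, hsqrt]
  refine ⟨fun U => hgram.mono fun ω hω => frobSq_mul_of_gram hω U, fun Z => ?_⟩
  have hPZ (ω : Ω) : frobSq ((P ω)ᵀ * Z) = (m : ℝ) / r * ∑ a : Fin r, ∑ b, ∑ i, ∑ j,
      O ω i (Fin.castLE hrm a) * O ω j (Fin.castLE hrm a) * (Z i b * Z j b) := by
    rw [hP, Matrix.transpose_smul, Matrix.smul_mul, frobSq_smul, hsqrt, frobSq_transpose_mul]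
    rfl
  have hint (i j k : Fin m) (c : ℝ) : Integrable (fun ω => O ω i k * O ω j k * c) μ :=
    (integrable_entry_mul_entry hOmeas hOorth i j k k).mul_const c
  have hintPZ : Integrable (fun ω => frobSq ((P ω)ᵀ * Z)) μ := by
    simp only [hPZ]
    exact (integrable_finsetSum _ fun a _ => integrable_finsetSum _ fun b _ =>
      integrable_finsetSum _ fun i _ => integrable_finsetSum _ fun j _ => hint _ _ _ _).const_mul _
  have hEPZ : ∫ ω, frobSq ((P ω)ᵀ * Z) ∂μ = frobSq Z := by
    simp only [hPZ]
    rw [integral_const_mul]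
    have hsum : ∫ ω, ∑ a : Fin r, ∑ b, ∑ i, ∑ j,
        O ω i (Fin.castLE hrm a) * O ω j (Fin.castLE hrm a) * (Z i b * Z j b) ∂μ
        = ∑ a : Fin r, ∑ b, ∑ i, ∑ j,
          (if i = j then (m : ℝ)⁻¹ else 0) * (Z i b * Z j b) := by
      rw [integral_finsetSum _ fun a _ => integrable_finsetSum _ fun b _ =>
        integrable_finsetSum _ fun i _ => integrable_finsetSum _ fun j _ => hint _ _ _ _]
      refine Finset.sum_congr rfl fun a _ => ?_
      rw [integral_finsetSum _ fun b _ =>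
        integrable_finsetSum _ fun i _ => integrable_finsetSum _ fun j _ => hint _ _ _ _]
      refine Finset.sum_congr rfl fun b _ => ?_
      rw [integral_finsetSum _ fun i _ => integrable_finsetSum _ fun j _ => hint _ _ _ _]
      refine Finset.sum_congr rfl fun i _ => ?_
      rw [integral_finsetSum _ fun j _ => hint _ _ _ _]
      refine Finset.sum_congr rfl fun j _ => ?_
      rw [integral_mul_const, integral_entry_mul_entry hOmeas hOorth hOhaar]
    rw [hsum]
    simp only [ite_mul, zero_mul, Finset.sum_ite_eq, Finset.mem_univ, if_true, ← Finset.mul_sum,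
      Finset.sum_const, Finset.card_univ, Fintype.card_fin, nsmul_eq_mul, ← sq, frobSq]
    rw [Finset.sum_comm]
    field_simp
  refine ⟨hEPZ, ?_⟩
  have hQZ : (fun ω => frobSq ((Q ω - 1) * Z)) =ᵐ[μ]
      fun ω => ((m : ℝ) / r - 2) * frobSq ((P ω)ᵀ * Z) + frobSq Z := by
    filter_upwards [hgram] with ω hω
    rw [hQ, frobSq_mul_transpose_sub_one_mul_of_gram hω]
  rw [integral_congr_ae hQZ, integral_add (hintPZ.const_mul _) (integrable_const _),
    integral_const_mul, hEPZ]
  simp only [integral_const, probReal_univ, one_smul]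
  ring
end

section
/- Let m ≥ 2 and 1 ≤ r ≤ m be integers, let P be a scaled Haar projector and Q := P Pᵀ, and let a := m(mr+m−2)/(r(m−1)(m+2)) and b := m(m−r)/(r(m−1)(m+2)). Then for every deterministic matrix A ∈ ℝ^{m×m}, E[Q A Q] = (a−b)·A + b·Aᵀ + b·tr(A)·I_m. Moreover a − 2b = m(r−1)/(r(m−1)); in particular a − 2b > 0 whenever r ≥ 2. -/
open MeasureTheory Matrix

/-- The coefficient `a = m(mr+m−2)/(r(m−1)(m+2))`. -/
noncomputable def aCoeff (m r : ℕ) : ℝ :=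
  (m : ℝ) * ((m : ℝ) * (r : ℝ) + (m : ℝ) - 2) / ((r : ℝ) * ((m : ℝ) - 1) * ((m : ℝ) + 2))

/-- The coefficient `b = m(m−r)/(r(m−1)(m+2))`. -/
noncomputable def bCoeff (m r : ℕ) : ℝ :=
  (m : ℝ) * ((m : ℝ) - (r : ℝ)) / ((r : ℝ) * ((m : ℝ) - 1) * ((m : ℝ) + 2))

section OrthogonalMoments

variable {m : ℕ}

/-- The orthogonal reflection that sends `e_p`, `e_q` to `(e_p + e_q)/√2`, `(e_p - e_q)/√2` and
fixes the other basis vectors. -/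
noncomputable def diagReflection (p q : Fin m) : Matrix (Fin m) (Fin m) ℝ :=
  Matrix.of fun i =>
    if i = p then (√2)⁻¹ • (Pi.single p 1 + Pi.single q 1)
    else if i = q then (√2)⁻¹ • (Pi.single p 1 - Pi.single q 1)
    else Pi.single i 1

lemma diagReflection_apply (p q i : Fin m) :
    diagReflection p q i =
      if i = p then (√2)⁻¹ • (Pi.single p 1 + Pi.single q 1)
      else if i = q then (√2)⁻¹ • (Pi.single p 1 - Pi.single q 1)
      else Pi.single i 1 := rfl

lemma diagReflection_transpose_mul_self {p q : Fin m} (hpq : p ≠ q) :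
    (diagReflection p q)ᵀ * diagReflection p q = 1 := by
  have h2 : (√2)⁻¹ * (√2)⁻¹ = (1 / 2 : ℝ) := by
    rw [← mul_inv, Real.mul_self_sqrt (by norm_num)]; norm_num
  rw [mul_eq_one_comm]
  ext i j
  change (diagReflection p q) i ⬝ᵥ (diagReflection p q) j = _
  simp only [diagReflection_apply, Matrix.one_apply]
  by_cases hip : i = p <;> by_cases hiq : i = q <;> by_cases hjp : j = p <;>
    by_cases hjq : j = q <;>
    simp_all [Pi.single_apply, mul_add] <;> grind

lemma diagReflection_conj_apply {p q : Fin m} (hpq : p ≠ q) {S : Matrix (Fin m) (Fin m) ℝ}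
    (hS : S.IsSymm) :
    (diagReflection p q * S * (diagReflection p q)ᵀ) p q = (S p p - S q q) / 2 := by
  have h2 : (√2)⁻¹ * (√2)⁻¹ = (1 / 2 : ℝ) := by
    rw [← mul_inv, Real.mul_self_sqrt (by norm_num)]; norm_num
  change ((diagReflection p q) p ᵥ* S) ⬝ᵥ (diagReflection p q) q = _
  simp only [diagReflection_apply, if_true, if_neg hpq.symm]
  simp only [smul_vecMul, add_vecMul, dotProduct_smul,
    dotProduct_sub, Pi.smul_apply, Pi.add_apply, single_one_vecMul, dotProduct_single_one, Matrix.row_apply, smul_eq_mul]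
  linear_combination (S p p + S q p - S p q - S q q) * h2 + (1 / 2) * hS.apply p q

/-- Second moment tensor of a random matrix. -/
noncomputable def secondMoment {Ω : Type*} [MeasurableSpace Ω] (μ : Measure Ω)
    (Q : Ω → Matrix (Fin m) (Fin m) ℝ) (i k l j : Fin m) : ℝ :=
  ∫ ω, Q ω i k * Q ω l j ∂μ

variable {Ω : Type*} [MeasurableSpace Ω] {μ : Measure Ω} {Q : Ω → Matrix (Fin m) (Fin m) ℝ}

/-- Invariance of the second moments under orthogonal conjugation. -/
def SecondMomentInvariant (μ : Measure Ω) (Q : Ω → Matrix (Fin m) (Fin m) ℝ) : Prop :=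
  ∀ g : Matrix (Fin m) (Fin m) ℝ, gᵀ * g = 1 → ∀ i k l j,
    secondMoment μ (fun ω => g * Q ω * gᵀ) i k l j = secondMoment μ Q i k l j

lemma SecondMomentInvariant.sign (h : SecondMomentInvariant μ Q) (s : Fin m → ℝ)
    (hs : ∀ i, s i * s i = 1) (i k l j : Fin m) :
    s i * s k * s l * s j * secondMoment μ Q i k l j = secondMoment μ Q i k l j := by
  conv_rhs => rw [← h (diagonal s) (by simp [hs]) i k l j]
  simp only [secondMoment, ← integral_const_mul]
  congr 1
  ext ω
  simp only [diagonal_transpose, diagonal_mul, mul_diagonal]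
  ring

lemma SecondMomentInvariant.perm (h : SecondMomentInvariant μ Q) (σ : Equiv.Perm (Fin m))
    (i k l j : Fin m) :
    secondMoment μ Q (σ i) (σ k) (σ l) (σ j) = secondMoment μ Q i k l j := by
  have hg : ((1 : Matrix (Fin m) (Fin m) ℝ).submatrix σ id)ᵀ *
      (1 : Matrix (Fin m) (Fin m) ℝ).submatrix σ id = 1 := by
    rw [mul_eq_one_comm, transpose_submatrix, transpose_one]
    ext a b
    simp [Matrix.mul_apply, Matrix.one_apply]
  rw [← h _ hg i k l j]
  have e : ∀ ω, (1 : Matrix (Fin m) (Fin m) ℝ).submatrix σ id * Q ω *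
      ((1 : Matrix (Fin m) (Fin m) ℝ).submatrix σ id)ᵀ = (Q ω).submatrix σ σ := by
    intro ω
    ext a b
    simp [Matrix.mul_apply, Matrix.one_apply]
  simp only [secondMoment, e, submatrix_apply]

lemma SecondMomentInvariant.eq_zero (h : SecondMomentInvariant μ Q) (p : Fin m) {i k l j : Fin m}
    (hp : (if i = p then -1 else 1 : ℝ) * (if k = p then -1 else 1) * (if l = p then -1 else 1) *
      (if j = p then -1 else 1) = -1) :
    secondMoment μ Q i k l j = 0 := by
  have := h.sign (fun a => if a = p then -1 else 1) (fun a => by split_ifs <;> norm_num) i k l j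
  simp only [hp] at this
  linarith

lemma SecondMomentInvariant.diag_eq (h : SecondMomentInvariant μ Q) (p q : Fin m) :
    secondMoment μ Q p p p p = secondMoment μ Q q q q q := by
  simpa using h.perm (Equiv.swap p q) q q q q

lemma exists_perm_map_pair {α : Type*} [DecidableEq α] {p q p' q' : α} (hpq : p ≠ q)
    (hpq' : p' ≠ q') : ∃ σ : Equiv.Perm α, σ p = p' ∧ σ q = q' := by
  refine ⟨Equiv.swap (Equiv.swap p p' q) q' * Equiv.swap p p', ?_, by simp⟩
  have h1 : p' ≠ Equiv.swap p p' q := fun e => hpq <|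
    (Equiv.swap p p').injective ((Equiv.swap_apply_left p p').trans e)
  simpa using Equiv.swap_apply_of_ne_of_ne h1 hpq'

lemma SecondMomentInvariant.offDiag_eq (h : SecondMomentInvariant μ Q) {p q p' q' : Fin m}
    (hpq : p ≠ q) (hpq' : p' ≠ q') :
    secondMoment μ Q p' p' q' q' = secondMoment μ Q p p q q ∧
      secondMoment μ Q p' q' p' q' = secondMoment μ Q p q p q := by
  obtain ⟨σ, rfl, rfl⟩ := exists_perm_map_pair hpq hpq'
  exact ⟨h.perm .., h.perm ..⟩

lemma SecondMomentInvariant.rotation (h : SecondMomentInvariant μ Q)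
    (hint : ∀ i k l j, Integrable (fun ω => Q ω i k * Q ω l j) μ)
    (hsymm : ∀ ω, (Q ω).IsSymm) {p q : Fin m} (hpq : p ≠ q) :
    secondMoment μ Q p p p p = secondMoment μ Q p p q q + 2 * secondMoment μ Q p q p q := by
  have h1 := h _ (diagReflection_transpose_mul_self hpq) p q p q
  have h2 : secondMoment μ (fun ω => diagReflection p q * Q ω * (diagReflection p q)ᵀ) p q p q =
      (secondMoment μ Q p p p p + secondMoment μ Q q q q q - 2 * secondMoment μ Q p p q q) / 4 := by
    simp only [secondMoment, diagReflection_conj_apply hpq (hsymm _)]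
    have hadd : Integrable (fun ω => Q ω p p * Q ω p p + Q ω q q * Q ω q q) μ :=
      (hint p p p p).add (hint q q q q)
    rw [← integral_const_mul, ← integral_add (hint ..) (hint ..),
      ← integral_sub hadd ((hint ..).const_mul 2), ← integral_div]
    congr 1
    ext ω
    ring
  have h3 := h.diag_eq p q
  linarith

lemma sum_eq_diag_add_offDiag (f : Fin m → Fin m → ℝ) (x y : ℝ) (hd : ∀ p, f p p = x)
    (ho : ∀ p q, p ≠ q → f p q = y) :
    ∑ p, ∑ q, f p q = m * x + m * (m - 1) * y := by
  have : ∀ p q, f p q = y + if p = q then x - y else 0 := by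
    intro p q
    split_ifs with h
    · subst h; rw [hd]; ring
    · rw [ho p q h]; ring
  simp only [this, Finset.sum_add_distrib, Finset.sum_ite_eq, Finset.mem_univ, if_true,
    Finset.sum_const, Finset.card_univ, Fintype.card_fin, nsmul_eq_mul]
  ring

/-- The second moments of an orthogonally invariant random multiple of a projection. -/
lemma SecondMomentInvariant.eq_coeff [IsProbabilityMeasure μ] (h : SecondMomentInvariant μ Q)
    (hint : ∀ i k l j, Integrable (fun ω => Q ω i k * Q ω l j) μ)
    (hsymm : ∀ ω, (Q ω).IsSymm) {r : ℕ} (hm : 2 ≤ m) (hr : 1 ≤ r)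
    (htr : ∀ᵐ ω ∂μ, (Q ω).trace = m) (hsq : ∀ᵐ ω ∂μ, Q ω * Q ω = ((m : ℝ) / r) • Q ω)
    (i k l j : Fin m) :
    secondMoment μ Q i k l j =
      (aCoeff m r - bCoeff m r) * (if i = k ∧ l = j then 1 else 0) +
        bCoeff m r * (if k = j ∧ i = l then 1 else 0) +
        bCoeff m r * (if i = j ∧ k = l then 1 else 0) := by
  have hsymm' : ∀ ω a b, Q ω a b = Q ω b a := fun ω a b => (hsymm ω).apply b a
  have hm' : (2 : ℝ) ≤ m := by exact_mod_cast hm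
  have hr' : (1 : ℝ) ≤ r := by exact_mod_cast hr
  let p₀ : Fin m := ⟨0, by omega⟩
  let q₀ : Fin m := ⟨1, by omega⟩
  have hpq : p₀ ≠ q₀ := by simp [p₀, q₀]
  obtain ⟨x, hx⟩ : ∃ x, x = secondMoment μ Q p₀ p₀ p₀ p₀ := ⟨_, rfl⟩
  obtain ⟨y, hy⟩ : ∃ y, y = secondMoment μ Q p₀ p₀ q₀ q₀ := ⟨_, rfl⟩
  obtain ⟨z, hz⟩ : ∃ z, z = secondMoment μ Q p₀ q₀ p₀ q₀ := ⟨_, rfl⟩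
  have hX : ∀ p, secondMoment μ Q p p p p = x := fun p => by rw [hx, h.diag_eq]
  have hY : ∀ p q, p ≠ q → secondMoment μ Q p p q q = y := fun p q e => by
    rw [hy, (h.offDiag_eq hpq e).1]
  have hZ : ∀ p q, p ≠ q → secondMoment μ Q p q p q = z := fun p q e => by
    rw [hz, (h.offDiag_eq hpq e).2]
  have hZ' : ∀ p q, p ≠ q → secondMoment μ Q p q q p = z := fun p q e => by
    rw [← hZ p q e]
    simp only [secondMoment, hsymm' _ q p]
  have e1 : x = y + 2 * z := by rw [hx, hy, hz, h.rotation hint hsymm hpq]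
  have e2 : (m : ℝ) * x + m * (m - 1) * y = m * m := by
    rw [← sum_eq_diag_add_offDiag (fun p q => secondMoment μ Q p p q q) x y hX hY]
    simp only [secondMoment]
    simp_rw [← integral_finsetSum Finset.univ (fun q _ => hint _ _ q q)]
    rw [← integral_finsetSum _ (fun p _ => integrable_finsetSum _ (fun q _ => hint p p q q))]
    rw [integral_congr_ae (g := fun _ => (m : ℝ) * m)]
    · simp
    · filter_upwards [htr] with ω hω
      rw [← Finset.sum_mul_sum]
      exact congrArg₂ (· * ·) hω hω
  have e3 : (m : ℝ) * x + m * (m - 1) * z = m / r * m := by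
    rw [← sum_eq_diag_add_offDiag (fun p q => secondMoment μ Q p q q p) x z hX hZ']
    simp only [secondMoment]
    simp_rw [← integral_finsetSum Finset.univ (fun q _ => hint _ q q _)]
    rw [← integral_finsetSum _ (fun p _ => integrable_finsetSum _ (fun q _ => hint p q q p))]
    rw [integral_congr_ae (g := fun _ => (m : ℝ) / r * m)]
    · simp
    · filter_upwards [htr, hsq] with ω hω hω'
      change (Q ω * Q ω).trace = _
      rw [hω', trace_smul, hω, smul_eq_mul]
  have hm0 : (m : ℝ) ≠ 0 := by positivity
  have hr0 : (r : ℝ) ≠ 0 := by positivity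
  have hm1 : (m : ℝ) - 1 ≠ 0 := by linarith
  have hm2 : (m : ℝ) + 2 ≠ 0 := by positivity
  have f2 : x + (m - 1) * y = m := mul_left_cancel₀ hm0 (by linarith)
  have f3 : x + (m - 1) * z = m / r := mul_left_cancel₀ hm0 (by linarith)
  have gx : (m + 2) * x = m + 2 * (m / r) := by
    linear_combination f2 + 2 * f3 + (m - 1) * e1
  have ex : x = m * (r + 2) / (r * (m + 2)) := by
    rw [eq_div_iff (mul_ne_zero hr0 hm2)]
    field_simp at gx
    linear_combination gx
  have ez : z = bCoeff m r := by
    have : (m - 1) * z = m / r - x := by linear_combination f3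
    apply mul_left_cancel₀ hm1
    rw [this, ex, bCoeff]
    field_simp
    ring
  have ey : y = aCoeff m r - bCoeff m r := by
    have : y = x - 2 * z := by linarith
    rw [this, ez, ex, aCoeff, bCoeff]
    field_simp
    ring
  rw [← ey, ← ez]
  by_cases hik : i = k
  · subst hik
    by_cases hlj : l = j
    · subst hlj
      by_cases hil : i = l
      · subst hil
        rw [hX]; simp; linarith
      · rw [hY _ _ hil]; simp [hil]
    · rw [h.eq_zero l (by by_cases hil : i = l <;> simp [hil, Ne.symm hlj])]
      have hijl : ¬ (i = j ∧ i = l) := fun e => hlj (e.2.symm.trans e.1)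
      simp [hlj, hijl]
  · by_cases hil : i = l
    · subst hil
      by_cases hkj : k = j
      · subst hkj
        rw [hZ _ _ hik]; simp [hik, Ne.symm hik]
      · rw [h.eq_zero k (by simp [hik, Ne.symm hkj])]
        simp [hik, hkj, Ne.symm hik]
    · by_cases hij : i = j
      · subst hij
        by_cases hkl : k = l
        · subst hkl
          rw [hZ' _ _ hik]; simp [hik]
        · rw [h.eq_zero k (by simp [hik, Ne.symm hkl])]
          simp [hik, hkl, hil]
      · rw [h.eq_zero i (by simp [Ne.symm hik, Ne.symm hil, Ne.symm hij])]
        simp [hik, hil, hij]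

end OrthogonalMoments

lemma abs_apply_le_one_of_transpose_mul_self {m : ℕ} {O : Matrix (Fin m) (Fin m) ℝ}
    (hO : Oᵀ * O = 1) (i j : Fin m) : |O i j| ≤ 1 := by
  have h := congrFun (congrFun hO j) j
  rw [Matrix.mul_apply, one_apply_eq] at h
  simp only [transpose_apply] at h
  have := Finset.single_le_sum (f := fun k => O k j * O k j)
    (fun k _ => mul_self_nonneg (O k j)) (Finset.mem_univ i)
  rw [abs_le_one_iff_mul_self_le_one]
  linarith

lemma aCoeff_sub_two_mul_bCoeff {m r : ℕ} (hm : 2 ≤ m) (hr : 1 ≤ r) :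
    aCoeff m r - 2 * bCoeff m r = (m : ℝ) * ((r : ℝ) - 1) / ((r : ℝ) * ((m : ℝ) - 1)) := by
  have hm' : (2 : ℝ) ≤ m := by exact_mod_cast hm
  have hr' : (1 : ℝ) ≤ r := by exact_mod_cast hr
  have hr0 : (r : ℝ) ≠ 0 := by positivity
  have hm1 : (m : ℝ) - 1 ≠ 0 := by linarith
  have hm2 : (m : ℝ) + 2 ≠ 0 := by positivity
  rw [aCoeff, bCoeff]
  field_simp
  ring

/-- For integers `m ≥ 2`, `1 ≤ r ≤ m`, a scaled Haar projector `P` with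
`Q := P Pᵀ`, and the coefficients `a, b` above: for every deterministic `A ∈ ℝ^{m×m}`,
`E[Q A Q] = (a−b)·A + b·Aᵀ + b·tr(A)·I` (entrywise). Moreover
`a − 2b = m(r−1)/(r(m−1))`; in particular `a − 2b > 0` whenever `r ≥ 2`. -/
theorem stmt2
    (m r : ℕ) (hm : 2 ≤ m) (hr : 1 ≤ r) (hrm : r ≤ m)
    {Ω : Type} [MeasurableSpace Ω] (μ : Measure Ω) [IsProbabilityMeasure μ]
    (O : Ω → Matrix (Fin m) (Fin m) ℝ) (hOmeas : Measurable O)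
    (hOorth : ∀ᵐ ω ∂μ, (O ω)ᵀ * O ω = 1)
    (hOhaar : ∀ g : Matrix (Fin m) (Fin m) ℝ, gᵀ * g = 1 →
      Measure.map (fun ω => g * O ω) μ = Measure.map O μ)
    (P : Ω → Matrix (Fin m) (Fin r) ℝ)
    (hP : ∀ ω, P ω = Real.sqrt ((m : ℝ) / r) • (O ω).submatrix id (Fin.castLE hrm))
    (Q : Ω → Matrix (Fin m) (Fin m) ℝ)
    (hQ : ∀ ω, Q ω = P ω * (P ω)ᵀ) :
    (∀ (A : Matrix (Fin m) (Fin m) ℝ) (i j : Fin m),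
      ∫ ω, (Q ω * A * Q ω) i j ∂μ =
        ((aCoeff m r - bCoeff m r) • A + bCoeff m r • Aᵀ
          + (bCoeff m r * A.trace) • (1 : Matrix (Fin m) (Fin m) ℝ)) i j) ∧
    (aCoeff m r - 2 * bCoeff m r = (m : ℝ) * ((r : ℝ) - 1) / ((r : ℝ) * ((m : ℝ) - 1))) ∧
    (2 ≤ r → 0 < aCoeff m r - 2 * bCoeff m r) := by
  have hab := aCoeff_sub_two_mul_bCoeff hm hr
  refine ⟨?_, hab, ?_⟩
  swap
  · intro h2
    rw [hab]
    have hm' : (2 : ℝ) ≤ m := by exact_mod_cast hm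
    have hr' : (2 : ℝ) ≤ r := by exact_mod_cast h2
    exact div_pos (mul_pos (by linarith) (by linarith)) (mul_pos (by linarith) (by linarith))
  have hr0 : (r : ℝ) ≠ 0 := by
    have : r ≠ 0 := by omega
    exact_mod_cast this
  have hc : (0 : ℝ) ≤ (m : ℝ) / r := by positivity
  let F : Matrix (Fin m) (Fin m) ℝ → Matrix (Fin m) (Fin m) ℝ := fun X =>
    ((m : ℝ) / r) • (X.submatrix id (Fin.castLE hrm) * (X.submatrix id (Fin.castLE hrm))ᵀ)
  have hQF : ∀ ω, Q ω = F (O ω) := fun ω => by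
    simp only [hQ, hP, F, transpose_smul, Matrix.smul_mul, Matrix.mul_smul, smul_smul,
      Real.mul_self_sqrt hc]
  have hFapp : ∀ X i j, F X i j =
      (m : ℝ) / r * ∑ k : Fin r, X i (Fin.castLE hrm k) * X j (Fin.castLE hrm k) := fun X i j => by
    simp [F, Matrix.mul_apply]
  have hent : ∀ i j, Measurable (fun X : Matrix (Fin m) (Fin m) ℝ => X i j) := fun i j =>
    (measurable_pi_apply j).comp (measurable_pi_apply (X := fun _ : Fin m => Fin m → ℝ) i)
  have hFmeas : ∀ i j, Measurable (fun X => F X i j) := fun i j => by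
    simp only [hFapp]
    exact (Finset.measurable_fun_sum _ fun k _ => (hent _ _).mul (hent _ _)).const_mul _
  have hgF : ∀ g X, F (g * X) = g * F X * gᵀ := fun g X => by
    have : (g * X).submatrix id (Fin.castLE hrm) = g * X.submatrix id (Fin.castLE hrm) := by
      ext i j
      simp [Matrix.mul_apply]
    simp only [F, this, transpose_mul, Matrix.mul_smul, Matrix.smul_mul, Matrix.mul_assoc]
  have hsymm : ∀ ω, (Q ω).IsSymm := fun ω => by
    rw [hQ]; simp [IsSymm, transpose_mul]
  have hgram : ∀ᵐ ω ∂μ, (P ω)ᵀ * P ω = ((m : ℝ) / r) • (1 : Matrix (Fin r) (Fin r) ℝ) := by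
    filter_upwards [hOorth] with ω hω
    have : ((O ω).submatrix id (Fin.castLE hrm))ᵀ * (O ω).submatrix id (Fin.castLE hrm) = 1 := by
      have h1 := congrArg (fun X => X.submatrix (Fin.castLE hrm) (Fin.castLE hrm)) hω
      simp only [submatrix_one _ (Fin.castLE_injective hrm)] at h1
      rw [← h1]
      ext i j
      simp [Matrix.mul_apply]
    rw [hP, transpose_smul, Matrix.smul_mul, Matrix.mul_smul, smul_smul, this,
      Real.mul_self_sqrt hc]
  have htr : ∀ᵐ ω ∂μ, (Q ω).trace = m := by
    filter_upwards [hgram] with ω hω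
    rw [hQ, trace_mul_comm, hω, trace_smul, trace_one, Fintype.card_fin, smul_eq_mul,
      div_mul_cancel₀ _ hr0]
  have hsq : ∀ᵐ ω ∂μ, Q ω * Q ω = ((m : ℝ) / r) • Q ω := by
    filter_upwards [hgram] with ω hω
    rw [hQ, Matrix.mul_assoc, ← Matrix.mul_assoc (P ω)ᵀ, hω, Matrix.smul_mul, Matrix.one_mul,
      Matrix.mul_smul]
  have hQmeas : ∀ i j, Measurable (fun ω => Q ω i j) := fun i j => by
    simp only [hQF]
    exact (hFmeas i j).comp hOmeas
  have hbound : ∀ᵐ ω ∂μ, ∀ i j, |Q ω i j| ≤ m := by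
    filter_upwards [hOorth] with ω hω i j
    rw [hQF, hFapp, abs_mul, abs_of_nonneg hc]
    calc (m : ℝ) / r * |∑ k : Fin r, O ω i (Fin.castLE hrm k) * O ω j (Fin.castLE hrm k)|
        ≤ (m : ℝ) / r * ∑ _k : Fin r, (1 : ℝ) := by
          refine mul_le_mul_of_nonneg_left ((Finset.abs_sum_le_sum_abs _ _).trans
            (Finset.sum_le_sum fun k _ => ?_)) hc
          rw [abs_mul]
          exact mul_le_one₀ (abs_apply_le_one_of_transpose_mul_self hω _ _) (abs_nonneg _)
            (abs_apply_le_one_of_transpose_mul_self hω _ _)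
      _ = m := by simp [div_mul_cancel₀ _ hr0]
  have hint : ∀ i k l j, Integrable (fun ω => Q ω i k * Q ω l j) μ := fun i k l j => by
    refine Integrable.of_bound ((hQmeas i k).mul (hQmeas l j)).aestronglyMeasurable
      ((m : ℝ) * m) ?_
    filter_upwards [hbound] with ω hω
    rw [Real.norm_eq_abs, abs_mul]
    exact mul_le_mul (hω _ _) (hω _ _) (abs_nonneg _) (by positivity)
  have hinv : SecondMomentInvariant μ Q := fun g hg i k l j => by
    have hG : Measurable (fun X => F X i k * F X l j) := (hFmeas i k).mul (hFmeas l j)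
    have hgO : Measurable (fun ω => g * O ω) := by
      refine measurable_pi_lambda _ fun a => measurable_pi_lambda _ fun b => ?_
      simp only [Matrix.mul_apply]
      exact Finset.measurable_fun_sum _ fun c _ => ((hent c b).comp hOmeas).const_mul _
    simp only [secondMoment, hQF, ← hgF]
    rw [← integral_map (φ := O) (f := fun X => F X i k * F X l j) hOmeas.aemeasurable
        hG.aestronglyMeasurable, ← hOhaar g hg,
      integral_map hgO.aemeasurable hG.aestronglyMeasurable]
  intro A i j
  have hexp : ∀ ω, (Q ω * A * Q ω) i j = ∑ l, ∑ k, A k l * (Q ω i k * Q ω l j) := fun ω => by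
    simp only [Matrix.mul_apply, Finset.sum_mul]
    exact Finset.sum_congr rfl fun l _ => Finset.sum_congr rfl fun k _ => by ring
  simp only [hexp]
  rw [integral_finsetSum _ fun l _ => integrable_finsetSum _ fun k _ => (hint i k l j).const_mul _]
  simp_rw [integral_finsetSum Finset.univ fun k _ => (hint i k _ j).const_mul (A k _),
    integral_const_mul]
  change ∑ l, ∑ k, A k l * secondMoment μ Q i k l j = _
  simp only [hinv.eq_coeff hint hsymm hm hr htr hsq, mul_add, Finset.sum_add_distrib, ite_and,
    mul_ite, mul_one, mul_zero, Finset.sum_ite_eq, Finset.sum_ite_eq', Finset.mem_univ, if_true,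
    Matrix.add_apply, Matrix.smul_apply, transpose_apply, smul_eq_mul, Matrix.one_apply,
    Matrix.trace, diag_apply, Finset.mul_sum]
  congr 1
  · congr 1
    · ring
    · simp [mul_comm]
  · split_ifs <;> simp [mul_comm]
end

section
/- Let m ≥ 2 and 1 ≤ r ≤ m be integers, let H_{ij} ∈ ℝ^{m×m} (i,j ∈ {1,…,n}) satisfy H_{ji} = H_{ij}ᵀ, with induced operators H, H♯ and trace matrix T. Let P be a scaled Haar projector with Q := P Pᵀ, and fix Z ∈ ℝ^{m×n}. Define A ∈ ℝ^{m×n} whose i-th column is A_{:,i} = Σ_{j=1}^n Q H_{ij} Q Z_{:,j}. Then E[A] = (a−b)·H[Z] + b·H♯[Z] + b·Z T, where a := m(mr+m−2)/(r(m−1)(m+2)) and b := m(m−r)/(r(m−1)(m+2)). -/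
open MeasureTheory Matrix

/-- The induced operator `H[Z]` with columns `(H[Z])_{:,i} = Σ_j H_{ij} Z_{:,j}`. -/
def fullOp {m n : ℕ} (H : Fin n → Fin n → Matrix (Fin m) (Fin m) ℝ)
    (Z : Matrix (Fin m) (Fin n) ℝ) : Matrix (Fin m) (Fin n) ℝ :=
  Matrix.of fun k i => ∑ j, (H i j).mulVec (fun l => Z l j) k

/-- The partial-transpose operator `H♯[Z]` with columns `Σ_j H_{ij}ᵀ Z_{:,j}`. -/
def sharpOp {m n : ℕ} (H : Fin n → Fin n → Matrix (Fin m) (Fin m) ℝ)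
    (Z : Matrix (Fin m) (Fin n) ℝ) : Matrix (Fin m) (Fin n) ℝ :=
  Matrix.of fun k i => ∑ j, (H i j)ᵀ.mulVec (fun l => Z l j) k

/-- The trace matrix `T ∈ ℝ^{n×n}` with `T_{ij} = tr(H_{ij})`. -/
noncomputable def traceMat {m n : ℕ} (H : Fin n → Fin n → Matrix (Fin m) (Fin m) ℝ) :
    Matrix (Fin n) (Fin n) ℝ :=
  Matrix.of fun i j => (H i j).trace

section InvariantTensor

variable {ι : Type*} [Fintype ι] [DecidableEq ι]

/-- A fourth-order tensor invariant under the diagonal action of the orthogonal group. -/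
def IsOrthogonalInvariant (M : ι → ι → ι → ι → ℝ) : Prop :=
  ∀ g : Matrix ι ι ℝ, gᵀ * g = 1 → ∀ a b c d,
    M a b c d = ∑ a', ∑ b', ∑ c', ∑ d', g a a' * g b b' * g c c' * g d d' * M a' b' c' d'

namespace IsOrthogonalInvariant

variable {M : ι → ι → ι → ι → ℝ}

lemma apply_sign (hM : IsOrthogonalInvariant M) (e a b c d : ι) :
    M a b c d = (if a = e then -1 else 1) * (if b = e then -1 else 1) *
      (if c = e then -1 else 1) * (if d = e then -1 else 1) * M a b c d := by
  have h := hM (diagonal fun x => if x = e then -1 else 1) (by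
    rw [diagonal_transpose, diagonal_mul_diagonal, ← diagonal_one]
    congr 1
    ext x
    split_ifs <;> norm_num) a b c d
  have hd : ∀ x y : ι, diagonal (fun x => if x = e then (-1 : ℝ) else 1) x y =
      (if x = e then -1 else 1) * if x = y then 1 else 0 := by
    intro x y
    rw [diagonal_apply, mul_ite, mul_one, mul_zero]
  simp only [hd] at h
  generalize (if a = e then (-1 : ℝ) else 1) = sa at h ⊢
  generalize (if b = e then (-1 : ℝ) else 1) = sb at h ⊢
  generalize (if c = e then (-1 : ℝ) else 1) = sc at h ⊢
  generalize (if d = e then (-1 : ℝ) else 1) = sd at h ⊢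
  simpa only [ite_mul, mul_ite, zero_mul, mul_zero, mul_one, Finset.sum_ite_eq,
    Finset.mem_univ, if_true, Finset.sum_const_zero] using h

lemma apply_perm (hM : IsOrthogonalInvariant M) (σ : Equiv.Perm ι) (a b c d : ι) :
    M a b c d = M (σ a) (σ b) (σ c) (σ d) := by
  have h := hM (Matrix.of fun x y => if σ x = y then 1 else 0) (by
    ext x y
    simp only [mul_apply, transpose_apply, of_apply, one_apply]
    rw [Fintype.sum_equiv σ _ (fun z => (if z = x then (1 : ℝ) else 0) * if z = y then 1 else 0)
      (fun _ => rfl)]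
    simp [eq_comm]) a b c d
  simpa only [of_apply, ite_mul, mul_ite, zero_mul, mul_zero, one_mul, mul_one,
    Finset.sum_ite_eq, Finset.mem_univ, if_true, Finset.sum_const_zero] using h

lemma diagonal_eq (hM : IsOrthogonalInvariant M) (h₁ : ∀ a b c d, M a b c d = M b a c d)
    (h₂ : ∀ a b c d, M a b c d = M c d a b) {a b : ι} (hab : a ≠ b) :
    M a a a a = M a a b b + 2 * M a b a b := by
  have hba := hab.symm
  have hv : (Pi.single a 1 - (2 : ℝ) • Pi.single b 1 : ι → ℝ) ⬝ᵥ
      (Pi.single a 1 - (2 : ℝ) • Pi.single b 1) = 5 := by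
    simp [dotProduct_sub, hab]
    norm_num
  set v : ι → ℝ := Pi.single a 1 - (2 : ℝ) • Pi.single b 1
  have hg : (1 - (2 / 5 : ℝ) • vecMulVec v v)ᵀ * (1 - (2 / 5 : ℝ) • vecMulVec v v) = 1 := by
    have hs : (vecMulVec v v)ᵀ = vecMulVec v v := by
      ext i j; simp [vecMulVec_apply, mul_comm]
    have hm : vecMulVec v v * vecMulVec v v = (5 : ℝ) • vecMulVec v v := by
      rw [vecMulVec_mul_vecMulVec, hv]
      ext i j; simp [vecMulVec_apply]; ring
    rw [transpose_sub, transpose_one, transpose_smul, hs, sub_mul, mul_sub, mul_sub,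
      one_mul, one_mul, mul_one, smul_mul_smul_comm, hm]
    module
  have hrow : ∀ x, (1 - (2 / 5 : ℝ) • vecMulVec v v) a x =
      (if a = x then 3 / 5 else 0) + (if b = x then 4 / 5 else 0) := by
    intro x
    by_cases hxa : a = x
    · subst hxa
      simp [vecMulVec_apply, v, hab, hba]; norm_num
    · by_cases hxb : b = x
      · subst hxb
        simp [vecMulVec_apply, v, hab, hba]; norm_num
      · simp [vecMulVec_apply, v, hab, hxa, hxb, Ne.symm hxa, Ne.symm hxb]
  have h := hM _ hg a a a a
  simp only [hrow, add_mul, mul_add, Finset.sum_add_distrib, ite_mul, mul_ite, zero_mul, mul_zero,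
    Finset.sum_ite_eq, Finset.mem_univ, if_true] at h
  have e₁ := hM.apply_sign b a a a b
  have e₂ := hM.apply_sign b a b b b
  simp only [hab, if_true, if_false] at e₁ e₂
  have p := hM.apply_perm (Equiv.swap a b) b b b b
  simp only [Equiv.swap_apply_right] at p
  linarith [h₁ a b a a, h₁ a b b a, h₁ a b a b, h₁ a b b b, h₂ a a a b, h₂ a a b a, h₂ b b a a,
    h₂ b b a b, h₂ b b b a, h₂ a b b a, h₂ a b b b, h₂ a b a a, h₁ b a b b, h₁ b a a a, h₂ b a a b,
    h₂ b a a a, h₂ b a b b]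

/-- An orthogonally invariant tensor with the symmetries of `(Q a b) * (Q c d)`, `Q` symmetric,
is a combination of the two isotropic tensors with these symmetries. -/
lemma eq_isotropic (hM : IsOrthogonalInvariant M) (h₁ : ∀ a b c d, M a b c d = M b a c d)
    (h₂ : ∀ a b c d, M a b c d = M c d a b) {i j : ι} (hij : i ≠ j) (a b c d : ι) :
    M a b c d = M i i j j * (1 : Matrix ι ι ℝ) a b * (1 : Matrix ι ι ℝ) c d +
      M i j i j * ((1 : Matrix ι ι ℝ) a c * (1 : Matrix ι ι ℝ) b d +
        (1 : Matrix ι ι ℝ) a d * (1 : Matrix ι ι ℝ) b c) := by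
  have hperm : ∀ a b : ι, a ≠ b → ∃ σ : Equiv.Perm ι, σ a = i ∧ σ b = j := by
    intro a b hab
    refine ⟨Equiv.swap (Equiv.swap a i b) j * Equiv.swap a i, ?_, ?_⟩
    · have : i ≠ Equiv.swap a i b := fun h => hab <|
        (Equiv.swap a i).injective ((Equiv.swap_apply_left a i).trans h)
      simp [Equiv.swap_apply_of_ne_of_ne this hij]
    · simp
  have hq : ∀ a b, a ≠ b → M a a b b = M i i j j := by
    intro a b hab
    obtain ⟨σ, ha, hb⟩ := hperm a b hab
    rw [hM.apply_perm σ, ha, hb]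
  have hs : ∀ a b, a ≠ b → M a b a b = M i j i j := by
    intro a b hab
    obtain ⟨σ, ha, hb⟩ := hperm a b hab
    rw [hM.apply_perm σ, ha, hb]
  have hp : ∀ a, M a a a a = M i i j j + 2 * M i j i j := by
    intro a
    rw [hM.apply_perm (Equiv.swap a i), Equiv.swap_apply_left]
    exact hM.diagonal_eq h₁ h₂ hij
  simp only [one_apply]
  by_cases hab : a = b
  · subst hab
    by_cases hcd : c = d
    · subst hcd
      by_cases hac : a = c
      · subst hac
        simp [hp]; ring
      · simp [hac, hq a c hac]
    · have e := hM.apply_sign c a a c d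
      simp only [Ne.symm hcd, if_true, if_false] at e
      have : M a a c d = 0 := by split_ifs at e <;> linarith
      rw [this, if_neg hcd]
      by_cases hac : a = c
      · subst hac
        simp [hcd]
      · simp [hac]
  · by_cases hac : a = c
    · subst hac
      by_cases hbd : b = d
      · subst hbd
        simp [hab, Ne.symm hab, hs a b hab]
      · have e := hM.apply_sign b a b a d
        simp only [hab, Ne.symm hbd, if_true, if_false] at e
        have : M a b a d = 0 := by linarith
        simp [this, hab, hbd, Ne.symm hab]
    · by_cases had : a = d
      · subst had
        by_cases hbc : b = c
        · subst hbc
          rw [h₁, hs b a (Ne.symm hab)]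
          simp [hab]
        · have e := hM.apply_sign b a b c a
          simp only [hab, Ne.symm hbc, if_true, if_false] at e
          have : M a b c a = 0 := by linarith
          simp [this, hab, hbc, hac]
      · have e := hM.apply_sign a a b c d
        simp only [Ne.symm hab, Ne.symm hac, Ne.symm had, if_true, if_false] at e
        have : M a b c d = 0 := by linarith
        simp [this, hab, hac, had]

end IsOrthogonalInvariant

end InvariantTensor

section RandomProjector

variable {Ω : Type*} [MeasurableSpace Ω] {μ : Measure Ω}

lemma isOrthogonalInvariant_integral {m : ℕ} {Q : Ω → Matrix (Fin m) (Fin m) ℝ}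
    (hint : ∀ a b c d, Integrable (fun ω => Q ω a b * Q ω c d) μ)
    (hinv : ∀ g : Matrix (Fin m) (Fin m) ℝ, gᵀ * g = 1 → ∀ a b c d,
      ∫ ω, Q ω a b * Q ω c d ∂μ = ∫ ω, (g * Q ω * gᵀ) a b * (g * Q ω * gᵀ) c d ∂μ) :
    IsOrthogonalInvariant fun a b c d => ∫ ω, Q ω a b * Q ω c d ∂μ := by
  intro g hg a b c d
  have hexp : ∀ ω, (g * Q ω * gᵀ) a b * (g * Q ω * gᵀ) c d =
      ∑ a', ∑ b', ∑ c', ∑ d', g a a' * g b b' * g c c' * g d d' * (Q ω a' b' * Q ω c' d') := by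
    intro ω
    have h : ∀ a b, (g * Q ω * gᵀ) a b = ∑ a', ∑ b', g a a' * g b b' * Q ω a' b' := by
      intro a b
      simp only [mul_apply, transpose_apply, Finset.sum_mul]
      rw [Finset.sum_comm]
      exact Finset.sum_congr rfl fun _ _ => Finset.sum_congr rfl fun _ _ => by ring
    rw [h, h]
    simp only [Finset.sum_mul]
    simp only [Finset.mul_sum]
    exact Finset.sum_congr rfl fun _ _ => Finset.sum_congr rfl fun _ _ =>
      Finset.sum_congr rfl fun _ _ => Finset.sum_congr rfl fun _ _ => by ring
  show ∫ ω, Q ω a b * Q ω c d ∂μ = _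
  rw [hinv g hg]
  simp only [hexp]
  have hi : ∀ a' b' c' d', Integrable (fun ω =>
      g a a' * g b b' * g c c' * g d d' * (Q ω a' b' * Q ω c' d')) μ :=
    fun _ _ _ _ => (hint _ _ _ _).const_mul _
  rw [integral_finsetSum _ fun _ _ => integrable_finsetSum _ fun _ _ =>
    integrable_finsetSum _ fun _ _ => integrable_finsetSum _ fun _ _ => hi _ _ _ _]
  refine Finset.sum_congr rfl fun _ _ => ?_
  rw [integral_finsetSum _ fun _ _ =>
    integrable_finsetSum _ fun _ _ => integrable_finsetSum _ fun _ _ => hi _ _ _ _]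
  refine Finset.sum_congr rfl fun _ _ => ?_
  rw [integral_finsetSum _ fun _ _ => integrable_finsetSum _ fun _ _ => hi _ _ _ _]
  refine Finset.sum_congr rfl fun _ _ => ?_
  rw [integral_finsetSum _ fun _ _ => hi _ _ _ _]
  exact Finset.sum_congr rfl fun _ _ => integral_const_mul _ _

lemma abs_mul_le_trace_mul_self {m : ℕ} {Q : Matrix (Fin m) (Fin m) ℝ} (hQ : Qᵀ = Q)
    (a b c d : Fin m) : |Q a b * Q c d| ≤ (Q * Q).trace := by
  have htr : (Q * Q).trace = ∑ x, ∑ y, Q x y ^ 2 := by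
    simp only [trace, diag_apply, mul_apply]
    refine Finset.sum_congr rfl fun x _ => Finset.sum_congr rfl fun y _ => ?_
    rw [sq, ← congrFun (congrFun hQ x) y, transpose_apply]
  have h : ∀ a b, Q a b ^ 2 ≤ (Q * Q).trace := by
    intro a b
    rw [htr]
    exact (Finset.single_le_sum (f := fun y => Q a y ^ 2) (fun _ _ => sq_nonneg _)
      (Finset.mem_univ b)).trans (Finset.single_le_sum (f := fun x => ∑ y, Q x y ^ 2)
        (fun _ _ => Finset.sum_nonneg fun _ _ => sq_nonneg _) (Finset.mem_univ a))
  rw [abs_le]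
  constructor <;> nlinarith [h a b, h c d, sq_nonneg (Q a b + Q c d), sq_nonneg (Q a b - Q c d)]

variable [IsProbabilityMeasure μ]

/-- Second moments of a random symmetric matrix with orthogonally invariant law, trace `m` and
`Q * Q = (m / r) • Q` almost surely. -/
lemma integral_mul_eq_isotropic {m r : ℕ} (hm : 2 ≤ m) (hr : 1 ≤ r)
    {Q : Ω → Matrix (Fin m) (Fin m) ℝ} (hsymm : ∀ ω, (Q ω)ᵀ = Q ω)
    (htr : ∀ᵐ ω ∂μ, (Q ω).trace = m) (hsq : ∀ᵐ ω ∂μ, (Q ω * Q ω).trace = (m : ℝ) ^ 2 / r)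
    (hint : ∀ a b c d, Integrable (fun ω => Q ω a b * Q ω c d) μ)
    (hinv : ∀ g : Matrix (Fin m) (Fin m) ℝ, gᵀ * g = 1 → ∀ a b c d,
      ∫ ω, Q ω a b * Q ω c d ∂μ = ∫ ω, (g * Q ω * gᵀ) a b * (g * Q ω * gᵀ) c d ∂μ)
    (a b c d : Fin m) :
    ∫ ω, Q ω a b * Q ω c d ∂μ =
      (aCoeff m r - bCoeff m r) * (1 : Matrix (Fin m) (Fin m) ℝ) a b *
        (1 : Matrix (Fin m) (Fin m) ℝ) c d +
      bCoeff m r * ((1 : Matrix (Fin m) (Fin m) ℝ) a c * (1 : Matrix (Fin m) (Fin m) ℝ) b d +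
        (1 : Matrix (Fin m) (Fin m) ℝ) a d * (1 : Matrix (Fin m) (Fin m) ℝ) b c) := by
  have hs : ∀ ω a b, Q ω a b = Q ω b a := fun ω a b => congrFun (congrFun (hsymm ω).symm a) b
  have hM := isOrthogonalInvariant_integral hint hinv
  obtain ⟨x, y, key⟩ : ∃ x y : ℝ, ∀ a b c d, ∫ ω, Q ω a b * Q ω c d ∂μ =
      x * (1 : Matrix (Fin m) (Fin m) ℝ) a b * (1 : Matrix (Fin m) (Fin m) ℝ) c d +
      y * ((1 : Matrix (Fin m) (Fin m) ℝ) a c * (1 : Matrix (Fin m) (Fin m) ℝ) b d +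
        (1 : Matrix (Fin m) (Fin m) ℝ) a d * (1 : Matrix (Fin m) (Fin m) ℝ) b c) :=
    ⟨_, _, hM.eq_isotropic (fun a b c d => by simp only [hs _ a b])
      (fun a b c d => by simp only [mul_comm]) (i := ⟨0, by lia⟩) (j := ⟨1, by lia⟩) (by simp)⟩
  have e₁ : (m : ℝ) ^ 2 = ∑ a, ∑ c, ∫ ω, Q ω a a * Q ω c c ∂μ := by
    simp only [← integral_finsetSum _ fun c _ => hint _ _ c c]
    rw [← integral_finsetSum _ fun a _ => integrable_finsetSum _ fun c _ => hint a a c c]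
    rw [integral_congr_ae (g := fun _ => (m : ℝ) ^ 2)]
    · simp
    · filter_upwards [htr] with ω h
      simp only [← Finset.mul_sum, ← Finset.sum_mul]
      rw [← h, sq]; rfl
  have e₂ : (m : ℝ) ^ 2 / r = ∑ a, ∑ b, ∫ ω, Q ω a b * Q ω b a ∂μ := by
    simp only [← integral_finsetSum _ fun b _ => hint _ b b _]
    rw [← integral_finsetSum _ fun a _ => integrable_finsetSum _ fun b _ => hint a b b a]
    rw [integral_congr_ae (g := fun _ => (m : ℝ) ^ 2 / r)]
    · simp
    · filter_upwards [hsq] with ω h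
      rw [← h]; rfl
  simp only [key, one_apply, Finset.sum_add_distrib, mul_add, mul_ite, mul_one, mul_zero,
    Finset.sum_ite_eq, Finset.sum_ite_eq', Finset.mem_univ, if_true,
    Finset.sum_const, Finset.card_univ, Fintype.card_fin, nsmul_eq_mul] at e₁ e₂
  have hm' : (2 : ℝ) ≤ m := by exact_mod_cast hm
  have hr' : (1 : ℝ) ≤ r := by exact_mod_cast hr
  have hr0 : (r : ℝ) ≠ 0 := by positivity
  have hm1 : (m : ℝ) - 1 ≠ 0 := by linarith
  have hm0 : (m : ℝ) ≠ 0 := by positivity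
  have hm2 : (m : ℝ) + 2 ≠ 0 := by positivity
  have k₁ : (m : ℝ) = m * x + 2 * y := by
    apply mul_left_cancel₀ hm0; linarith
  have k₂ : (m : ℝ) = r * (x + (m + 1) * y) := by
    rw [div_eq_iff hr0] at e₂
    apply mul_left_cancel₀ hm0; linarith
  have hy : y = bCoeff m r := by
    rw [bCoeff, eq_div_iff (by positivity)]
    linear_combination (r : ℝ) * k₁ - m * k₂
  have hx : x = aCoeff m r - bCoeff m r := by
    rw [← hy, eq_sub_iff_add_eq, aCoeff, eq_div_iff (by positivity)]
    have hy' := hy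
    rw [bCoeff, eq_div_iff (by positivity)] at hy'
    apply mul_left_cancel₀ hm0
    linear_combination (-(r : ℝ) * (m - 1) * (m + 2)) * k₁ + (m - 2) * hy'
  rw [key, hx, hy]

end RandomProjector

/-- Let `m ≥ 2`, `1 ≤ r ≤ m`, and `H_{ij} ∈ ℝ^{m×m}` with
`H_{ji} = H_{ij}ᵀ`, with induced operators `H`, `H♯` and trace matrix `T`. Let `P` be a
scaled Haar projector with `Q := P Pᵀ` and fix `Z ∈ ℝ^{m×n}`. If `A ∈ ℝ^{m×n}` has
`i`-th column `Σ_j Q H_{ij} Q Z_{:,j}`, then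
`E[A] = (a−b)·H[Z] + b·H♯[Z] + b·Z T` (entrywise). -/
theorem stmt8
    (m r n : ℕ) (hm : 2 ≤ m) (hr : 1 ≤ r) (hrm : r ≤ m)
    (H : Fin n → Fin n → Matrix (Fin m) (Fin m) ℝ)
    (hHsym : ∀ i j, H j i = (H i j)ᵀ)
    {Ω : Type} [MeasurableSpace Ω] (μ : Measure Ω) [IsProbabilityMeasure μ]
    (O : Ω → Matrix (Fin m) (Fin m) ℝ) (hOmeas : Measurable O)
    (hOorth : ∀ᵐ ω ∂μ, (O ω)ᵀ * O ω = 1)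
    (hOhaar : ∀ g : Matrix (Fin m) (Fin m) ℝ, gᵀ * g = 1 →
      Measure.map (fun ω => g * O ω) μ = Measure.map O μ)
    (P : Ω → Matrix (Fin m) (Fin r) ℝ)
    (hP : ∀ ω, P ω = Real.sqrt ((m : ℝ) / r) • (O ω).submatrix id (Fin.castLE hrm))
    (Q : Ω → Matrix (Fin m) (Fin m) ℝ)
    (hQ : ∀ ω, Q ω = P ω * (P ω)ᵀ)
    (Z : Matrix (Fin m) (Fin n) ℝ)
    (A : Ω → Matrix (Fin m) (Fin n) ℝ)
    (hA : ∀ ω, A ω = Matrix.of fun k i =>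
      ∑ j, (Q ω * H i j * Q ω).mulVec (fun l => Z l j) k) :
    ∀ (k : Fin m) (i : Fin n),
      ∫ ω, A ω k i ∂μ =
        ((aCoeff m r - bCoeff m r) • fullOp H Z + bCoeff m r • sharpOp H Z
          + bCoeff m r • (Z * traceMat H)) k i := by
  have hQsymm : ∀ ω, (Q ω)ᵀ = Q ω := fun ω => by rw [hQ, transpose_mul, transpose_transpose]
  have hr' : (0 : ℝ) < r := by exact_mod_cast hr
  have hPP : ∀ᵐ ω ∂μ, (P ω)ᵀ * P ω = ((m : ℝ) / r) • (1 : Matrix (Fin r) (Fin r) ℝ) := by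
    filter_upwards [hOorth] with ω h
    have hsub : ((O ω).submatrix id (Fin.castLE hrm))ᵀ * (O ω).submatrix id (Fin.castLE hrm) =
        1 := by
      ext s t
      have := congrFun (congrFun h (Fin.castLE hrm s)) (Fin.castLE hrm t)
      simpa [mul_apply, one_apply] using this
    rw [hP, transpose_smul, Matrix.smul_mul, Matrix.mul_smul, hsub, smul_smul,
      Real.mul_self_sqrt (by positivity)]
  have htr : ∀ᵐ ω ∂μ, (Q ω).trace = m := by
    filter_upwards [hPP] with ω h
    rw [hQ, trace_mul_comm, h, trace_smul, trace_one, Fintype.card_fin, smul_eq_mul,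
      div_mul_cancel₀ _ hr'.ne']
  have hsq : ∀ᵐ ω ∂μ, (Q ω * Q ω).trace = (m : ℝ) ^ 2 / r := by
    filter_upwards [hPP, htr] with ω h h'
    have : Q ω * Q ω = ((m : ℝ) / r) • Q ω := by
      rw [hQ, Matrix.mul_assoc, ← Matrix.mul_assoc (P ω)ᵀ, h, Matrix.smul_mul, Matrix.one_mul,
        Matrix.mul_smul]
    rw [this, trace_smul, h', smul_eq_mul]
    ring
  have hentry : ∀ a b, Measurable fun X : Matrix (Fin m) (Fin m) ℝ => X a b := fun a b =>
    (measurable_pi_apply b).comp (measurable_pi_apply a)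
  let G : Matrix (Fin m) (Fin m) ℝ → Matrix (Fin m) (Fin m) ℝ := fun X =>
    (Real.sqrt ((m : ℝ) / r) • X.submatrix id (Fin.castLE hrm)) *
      (Real.sqrt ((m : ℝ) / r) • X.submatrix id (Fin.castLE hrm))ᵀ
  have hQG : ∀ ω, Q ω = G (O ω) := fun ω => by rw [hQ, hP]
  have hG : ∀ a b, Measurable fun X => G X a b := by
    intro a b
    simp only [G, mul_apply, transpose_apply, Matrix.smul_apply, submatrix_apply, smul_eq_mul]
    exact Finset.measurable_sum _ fun s _ => ((hentry a _).const_mul _).mul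
      ((hentry b _).const_mul _)
  have hGconj : ∀ g X, G (g * X) = g * G X * gᵀ := by
    intro g X
    have : (g * X).submatrix id (Fin.castLE hrm) = g * X.submatrix id (Fin.castLE hrm) := by
      ext; simp [mul_apply]
    simp only [G, this, ← Matrix.mul_smul, transpose_mul, Matrix.mul_assoc]
  have hint : ∀ a b c d, Integrable (fun ω => Q ω a b * Q ω c d) μ := by
    intro a b c d
    refine Integrable.of_bound (C := (m : ℝ) ^ 2 / r) ?_ ?_
    · simp only [hQG]
      exact (((hG a b).mul (hG c d)).comp hOmeas).aestronglyMeasurable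
    · filter_upwards [hsq] with ω h
      rw [Real.norm_eq_abs, ← h]
      exact abs_mul_le_trace_mul_self (hQsymm ω) a b c d
  have hinv : ∀ g : Matrix (Fin m) (Fin m) ℝ, gᵀ * g = 1 → ∀ a b c d,
      ∫ ω, Q ω a b * Q ω c d ∂μ = ∫ ω, (g * Q ω * gᵀ) a b * (g * Q ω * gᵀ) c d ∂μ := by
    intro g hg a b c d
    have hf : Measurable fun X => G X a b * G X c d := (hG a b).mul (hG c d)
    have hgO : Measurable fun ω => g * O ω := by
      refine measurable_pi_iff.2 fun x => measurable_pi_iff.2 fun y => ?_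
      simp only [mul_apply]
      exact Finset.measurable_sum _ fun z _ => ((hentry z y).comp hOmeas).const_mul _
    simp only [hQG, ← hGconj]
    rw [← integral_map hOmeas.aemeasurable hf.aestronglyMeasurable, ← hOhaar g hg,
      integral_map hgO.aemeasurable hf.aestronglyMeasurable]
  have key := integral_mul_eq_isotropic hm hr hQsymm htr hsq hint hinv
  intro k i
  have hexp : ∀ ω, A ω k i = ∑ j, ∑ l, ∑ c, ∑ b, H i j b c * Z l j * (Q ω k b * Q ω c l) := by
    intro ω
    simp only [hA, of_apply, mulVec, dotProduct, mul_apply, Finset.sum_mul]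
    exact Finset.sum_congr rfl fun _ _ => Finset.sum_congr rfl fun _ _ =>
      Finset.sum_congr rfl fun _ _ => Finset.sum_congr rfl fun _ _ => by ring
  have hi : ∀ j l c b, Integrable (fun ω => H i j b c * Z l j * (Q ω k b * Q ω c l)) μ :=
    fun _ _ _ _ => (hint _ _ _ _).const_mul _
  have hE : ∫ ω, A ω k i ∂μ =
      ∑ j, ∑ l, ∑ c, ∑ b, H i j b c * Z l j * ∫ ω, Q ω k b * Q ω c l ∂μ := by
    simp only [hexp]
    rw [integral_finsetSum _ fun _ _ => integrable_finsetSum _ fun _ _ =>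
      integrable_finsetSum _ fun _ _ => integrable_finsetSum _ fun _ _ => hi _ _ _ _]
    refine Finset.sum_congr rfl fun _ _ => ?_
    rw [integral_finsetSum _ fun _ _ =>
      integrable_finsetSum _ fun _ _ => integrable_finsetSum _ fun _ _ => hi _ _ _ _]
    refine Finset.sum_congr rfl fun _ _ => ?_
    rw [integral_finsetSum _ fun _ _ => integrable_finsetSum _ fun _ _ => hi _ _ _ _]
    refine Finset.sum_congr rfl fun _ _ => ?_
    rw [integral_finsetSum _ fun _ _ => hi _ _ _ _]
    exact Finset.sum_congr rfl fun _ _ => integral_const_mul _ _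
  rw [hE]
  simp only [Matrix.add_apply, Matrix.smul_apply, smul_eq_mul, fullOp, sharpOp, traceMat, of_apply, mulVec,
    dotProduct, mul_apply, transpose_apply, Finset.mul_sum, ← Finset.sum_add_distrib]
  refine Finset.sum_congr rfl fun j _ => ?_
  simp only [key, one_apply, Finset.sum_add_distrib, mul_add, mul_ite, mul_one, mul_zero,
    Finset.sum_ite_irrel, Finset.sum_ite_eq, Finset.sum_ite_eq', Finset.mem_univ, if_true,
    Finset.sum_const_zero]
  rw [hHsym i j, trace_transpose, trace]
  simp only [diag_apply, Finset.mul_sum]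
  rw [← add_assoc]
  congr 1
  · congr 1
    · exact Finset.sum_congr rfl fun _ _ => by ring
    · exact Finset.sum_congr rfl fun _ _ => by ring
  · exact Finset.sum_congr rfl fun _ _ => by ring
end

section
/- Let E and Y be finite-dimensional real inner product spaces, and let μ > 0 and L > 0. Let g : E × Y → ℝ be differentiable with gradient that is L-Lipschitz with respect to the product norm ‖(x,y)‖ = sqrt(‖x‖² + ‖y‖²), and suppose that for every x ∈ E the function y ↦ g(x,y) is μ-strongly convex and attains its minimum at a unique point Y*(x) ∈ Y. Then the map Y* is Lipschitz: ‖Y*(x) − Y*(x')‖ ≤ (L/μ)·‖x − x'‖ for all x, x' ∈ E. -/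
open Set

/-- The derivative of a differentiable `μ`-strongly convex function is `μ`-strongly monotone. -/
theorem mul_sq_norm_sub_le_of_hasFDerivAt {F : Type*} [NormedAddCommGroup F]
    [InnerProductSpace ℝ F] {μ : ℝ} {f : F → ℝ}
    (hf : ConvexOn ℝ univ fun y => f y - μ / 2 * ‖y‖ ^ 2) {a b : F} {fa fb : F →L[ℝ] ℝ}
    (ha : HasFDerivAt f fa a) (hb : HasFDerivAt f fb b) :
    μ * ‖b - a‖ ^ 2 ≤ fb (b - a) - fa (b - a) := by
  have hline (t : ℝ) : HasDerivAt (AffineMap.lineMap a b : ℝ → F) (b - a) t :=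
    AffineMap.hasDerivAt_lineMap
  have hconv := hf.comp_affineMap (AffineMap.lineMap a b : ℝ →ᵃ[ℝ] F)
  rw [preimage_univ] at hconv
  have hderiv (t : ℝ) {f' : F →L[ℝ] ℝ} (h : HasFDerivAt f f' (AffineMap.lineMap a b t)) :
      HasDerivAt ((fun y => f y - μ / 2 * ‖y‖ ^ 2) ∘ (AffineMap.lineMap a b : ℝ →ᵃ[ℝ] F))
        (f' (b - a) - μ / 2 * (2 * inner ℝ (AffineMap.lineMap a b t) (b - a))) t :=
    (h.comp_hasDerivAt t (hline t)).sub ((hline t).norm_sq.const_mul (μ / 2))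
  have h0 := hconv.le_slope_of_hasDerivAt (mem_univ 0) (mem_univ 1) one_pos
    (hderiv 0 (by simpa using ha))
  have h1 := hconv.slope_le_of_hasDerivAt (mem_univ 0) (mem_univ 1) one_pos
    (hderiv 1 (by simpa using hb))
  have h := h0.trans h1
  rw [AffineMap.lineMap_apply_zero, AffineMap.lineMap_apply_one] at h
  have hsq : ‖b - a‖ ^ 2 = inner ℝ b (b - a) - inner ℝ a (b - a) := by
    rw [← inner_sub_left, real_inner_self_eq_norm_sq]
  rw [hsq]
  linarith

/-- The partial derivative in the second variable of a function on an `ℓ²`-product, expressed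
through its gradient. -/
theorem hasFDerivAt_toLp_prodMk_right {E Y : Type*}
    [NormedAddCommGroup E] [InnerProductSpace ℝ E] [CompleteSpace E]
    [NormedAddCommGroup Y] [InnerProductSpace ℝ Y] [CompleteSpace Y]
    {g : WithLp 2 (E × Y) → ℝ} {x : E} {y : Y}
    (hg : DifferentiableAt ℝ g (WithLp.toLp 2 (x, y))) :
    HasFDerivAt (fun y => g (WithLp.toLp 2 (x, y)))
      (innerSL ℝ (gradient g (WithLp.toLp 2 (x, y))).snd) y := by
  have h := hg.hasGradientAt.hasFDerivAt.comp y
    ((WithLp.prodContinuousLinearEquiv 2 ℝ E Y).symm.hasFDerivAt.comp y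
      (hasFDerivAt_prodMk_right x y))
  refine h.congr_fderiv ?_
  ext v
  change inner ℝ (gradient g (WithLp.toLp 2 (x, y))) (WithLp.toLp 2 ((0 : E), v)) = _
  simp [WithLp.prod_inner_apply, -inner_gradient_left]

/-- Let `E`, `Y` be finite-dimensional real inner product spaces and
`μ, L > 0`. Let `g : E × Y → ℝ` (with `E × Y` carrying the ℓ²-product norm
`‖(x,y)‖ = √(‖x‖² + ‖y‖²)`, i.e. the domain is `WithLp 2 (E × Y)`) be differentiable
with `L`-Lipschitz gradient, and suppose for every `x` the function `y ↦ g(x,y)` is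
`μ`-strongly convex (i.e. `g(x,·) − (μ/2)‖·‖²` is convex) and attains its minimum at a
unique point `Y*(x)`. Then `‖Y*(x) − Y*(x')‖ ≤ (L/μ)·‖x − x'‖` for all `x, x'`. -/
theorem stmt12
    {E Y : Type*}
    [NormedAddCommGroup E] [InnerProductSpace ℝ E] [FiniteDimensional ℝ E]
    [NormedAddCommGroup Y] [InnerProductSpace ℝ Y] [FiniteDimensional ℝ Y]
    (μ L : ℝ) (hμ : 0 < μ) (hL : 0 < L)
    (g : WithLp 2 (E × Y) → ℝ)
    (hg : Differentiable ℝ g)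
    (hgrad : ∀ p q : WithLp 2 (E × Y), ‖gradient g p - gradient g q‖ ≤ L * ‖p - q‖)
    (hconv : ∀ x : E, ConvexOn ℝ univ
      (fun y : Y => g ((WithLp.equiv 2 (E × Y)).symm (x, y)) - μ / 2 * ‖y‖ ^ 2))
    (Ystar : E → Y)
    (hmin : ∀ x y, g ((WithLp.equiv 2 (E × Y)).symm (x, Ystar x)) ≤
      g ((WithLp.equiv 2 (E × Y)).symm (x, y)))
    (huniq : ∀ x y, (∀ y', g ((WithLp.equiv 2 (E × Y)).symm (x, y)) ≤
      g ((WithLp.equiv 2 (E × Y)).symm (x, y'))) → y = Ystar x) :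
    ∀ x x' : E, ‖Ystar x - Ystar x'‖ ≤ (L / μ) * ‖x - x'‖ := by
  intro x x'
  have hD (x : E) (y : Y) := hasFDerivAt_toLp_prodMk_right (hg (WithLp.toLp 2 (x, y)))
  have hcrit (x : E) : (gradient g (WithLp.toLp 2 (x, Ystar x))).snd = 0 := by
    have hloc : IsLocalMin (fun y => g (WithLp.toLp 2 (x, y))) (Ystar x) :=
      Filter.Eventually.of_forall (hmin x)
    have h := hloc.hasFDerivAt_eq_zero (hD x (Ystar x))
    simpa using congrArg (fun f => f (gradient g (WithLp.toLp 2 (x, Ystar x))).snd) h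
  have hmono := mul_sq_norm_sub_le_of_hasFDerivAt (hconv x') (hD x' (Ystar x')) (hD x' (Ystar x))
  rw [hcrit x', map_zero, zero_apply, sub_zero, innerSL_apply_apply] at hmono
  set G := gradient g (WithLp.toLp 2 (x', Ystar x))
  have hG : ‖G.snd‖ ≤ L * ‖x - x'‖ := by
    have h := hgrad (WithLp.toLp 2 (x', Ystar x)) (WithLp.toLp 2 (x, Ystar x))
    have hnorm : ‖(WithLp.toLp 2 (x', Ystar x) : WithLp 2 (E × Y)) -
        WithLp.toLp 2 (x, Ystar x)‖ = ‖x - x'‖ := by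
      rw [← WithLp.toLp_sub, Prod.mk_sub_mk, sub_self, WithLp.norm_toLp_fst, norm_sub_rev]
    rw [hnorm] at h
    calc ‖G.snd‖ = ‖(G - gradient g (WithLp.toLp 2 (x, Ystar x))).snd‖ := by
          rw [WithLp.sub_snd, hcrit x, sub_zero]
      _ ≤ _ := WithLp.norm_snd_le _ _
      _ ≤ _ := h
  have hinner := hmono.trans (real_inner_le_norm _ _)
  rcases (norm_nonneg (Ystar x - Ystar x')).eq_or_lt with h0 | hpos
  · rw [← h0]
    positivity
  · rw [div_mul_eq_mul_div, le_div_iff₀ hμ]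
    refine le_of_mul_le_mul_right ?_ hpos
    calc _ = μ * ‖Ystar x - Ystar x'‖ ^ 2 := by ring
      _ ≤ _ := hinner
      _ ≤ _ := by gcongr
end

section
/- Let g : ℝ^d × ℝ^p → ℝ be twice continuously differentiable, let f : ℝ^d × ℝ^p → ℝ be continuously differentiable, and suppose there is μ > 0 such that for every x ∈ ℝ^d the function y ↦ g(x,y) is μ-strongly convex, with unique minimizer Y*(x). Then: (1) Y* is continuously differentiable, and the Hessian block H(x) := ∇²_{yy} g(x, Y*(x)) ∈ ℝ^{p×p} is positive definite (hence invertible); (2) the function Φ(x) := f(x, Y*(x)) is differentiable with ∇Φ(x) = ∇_x f(x, Y*(x)) − J(x)[H(x)⁻¹ ∇_y f(x, Y*(x))], where J(x) ∈ ℝ^{d×p} is the mixed second-derivative block with entries J(x)_{ij} = ∂²g/∂x_i∂y_j evaluated at (x, Y*(x)). -/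
open Matrix

/-- The second-derivative pairing `D²g(q)[v, w]`. -/
noncomputable def mixedD2 {d p : ℕ} (g : (Fin d → ℝ) × (Fin p → ℝ) → ℝ)
    (q v w : (Fin d → ℝ) × (Fin p → ℝ)) : ℝ :=
  fderiv ℝ (fderiv ℝ g) q v w

/-- The Hessian block `∇²_{yy} g(q) ∈ ℝ^{p×p}`, with entries `∂²g/∂y_i∂y_j` at `q`. -/
noncomputable def Hblk {d p : ℕ} (g : (Fin d → ℝ) × (Fin p → ℝ) → ℝ)
    (q : (Fin d → ℝ) × (Fin p → ℝ)) : Matrix (Fin p) (Fin p) ℝ :=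
  Matrix.of fun i j =>
    mixedD2 g q ((0 : Fin d → ℝ), Pi.single i 1) ((0 : Fin d → ℝ), Pi.single j 1)

/-- The mixed block `J(q) ∈ ℝ^{d×p}`, with entries `∂²g/∂x_i∂y_j` at `q`. -/
noncomputable def Jblk {d p : ℕ} (g : (Fin d → ℝ) × (Fin p → ℝ) → ℝ)
    (q : (Fin d → ℝ) × (Fin p → ℝ)) : Matrix (Fin d) (Fin p) ℝ :=
  Matrix.of fun i j =>
    mixedD2 g q (Pi.single i 1, (0 : Fin p → ℝ)) ((0 : Fin d → ℝ), Pi.single j 1)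

section Helpers

variable {d p : ℕ}

/-- The partial gradient `∇_y g`, as a vector-valued function. -/
noncomputable def gradY (g : (Fin d → ℝ) × (Fin p → ℝ) → ℝ)
    (q : (Fin d → ℝ) × (Fin p → ℝ)) : Fin p → ℝ :=
  fun j => fderiv ℝ g q ((0 : Fin d → ℝ), Pi.single j 1)

theorem clm_zero_prod_eq_dotProduct (L : (Fin d → ℝ) × (Fin p → ℝ) →L[ℝ] ℝ) (v : Fin p → ℝ) :
    L ((0 : Fin d → ℝ), v) = v ⬝ᵥ fun j => L ((0 : Fin d → ℝ), Pi.single j 1) := by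
  have h := congrArg (L ∘L .inr ℝ (Fin d → ℝ) (Fin p → ℝ)) (pi_eq_sum_univ' v)
  simpa [dotProduct, ← Pi.single_apply, Pi.single, Function.update_apply, map_sum] using h

theorem mixedD2_zero_zero_eq (g : (Fin d → ℝ) × (Fin p → ℝ) → ℝ)
    (q : (Fin d → ℝ) × (Fin p → ℝ)) (v : Fin p → ℝ) (j : Fin p) :
    mixedD2 g q ((0 : Fin d → ℝ), v) ((0 : Fin d → ℝ), Pi.single j 1) = (v ᵥ* Hblk g q) j :=
  clm_zero_prod_eq_dotProduct
    ((fderiv ℝ (fderiv ℝ g) q).flip ((0 : Fin d → ℝ), Pi.single j 1)) v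

theorem mixedD2_quadratic_eq (g : (Fin d → ℝ) × (Fin p → ℝ) → ℝ)
    (q : (Fin d → ℝ) × (Fin p → ℝ)) (v : Fin p → ℝ) :
    mixedD2 g q ((0 : Fin d → ℝ), v) ((0 : Fin d → ℝ), v) = v ⬝ᵥ (Hblk g q *ᵥ v) := by
  rw [dotProduct_mulVec, dotProduct_comm]
  exact (clm_zero_prod_eq_dotProduct _ v).trans
    (congrArg (v ⬝ᵥ ·) (funext (mixedD2_zero_zero_eq g q v)))

theorem hasFDerivAt_fderiv_apply {g : (Fin d → ℝ) × (Fin p → ℝ) → ℝ} (hg : ContDiff ℝ 2 g)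
    (q w : (Fin d → ℝ) × (Fin p → ℝ)) :
    HasFDerivAt (fun q => fderiv ℝ g q w) ((fderiv ℝ (fderiv ℝ g) q).flip w) q := by
  have h := ((hg.fderiv_right (m := 1) (by norm_num)).differentiable (by norm_num) q).hasFDerivAt
  simpa using h.clm_apply (hasFDerivAt_const w q)

theorem contDiff_gradY {g : (Fin d → ℝ) × (Fin p → ℝ) → ℝ} (hg : ContDiff ℝ 2 g) :
    ContDiff ℝ 1 (gradY g) :=
  contDiff_pi.2 fun _ => (hg.fderiv_right (m := 1) (by norm_num)).clm_apply contDiff_const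

theorem fderiv_gradY_apply {g : (Fin d → ℝ) × (Fin p → ℝ) → ℝ} (hg : ContDiff ℝ 2 g)
    (q v : (Fin d → ℝ) × (Fin p → ℝ)) (j : Fin p) :
    fderiv ℝ (gradY g) q v j = mixedD2 g q v ((0 : Fin d → ℝ), Pi.single j 1) := by
  have h : HasFDerivAt (gradY g) (ContinuousLinearMap.pi fun j =>
      (fderiv ℝ (fderiv ℝ g) q).flip ((0 : Fin d → ℝ), Pi.single j 1)) q :=
    hasFDerivAt_pi.2 fun j => hasFDerivAt_fderiv_apply hg q (0, Pi.single j 1)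
  rw [h.fderiv]
  rfl

theorem hasDerivAt_fiber_line (x : Fin d → ℝ) (y v : Fin p → ℝ) (t : ℝ) :
    HasDerivAt (fun t : ℝ => (x, y + t • v)) ((0 : Fin d → ℝ), v) t := by
  simpa using (hasDerivAt_const t x).prodMk (((hasDerivAt_id t).smul_const v).const_add y)

/-- Along a line in a fibre, the directional derivative of a strongly convex function minus that of
the quadratic is monotone. -/
theorem monotone_fderiv_sub_of_convexOn {μ : ℝ} {g : (Fin d → ℝ) × (Fin p → ℝ) → ℝ}
    (hg : Differentiable ℝ g) {x : Fin d → ℝ}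
    (hconv : ConvexOn ℝ Set.univ (fun y : Fin p → ℝ => g (x, y) - μ / 2 * ∑ j, (y j) ^ 2))
    (y v : Fin p → ℝ) :
    Monotone fun t : ℝ =>
      fderiv ℝ g (x, y + t • v) ((0 : Fin d → ℝ), v) - μ * ((y + t • v) ⬝ᵥ v) := by
  set φ : ℝ → ℝ := fun t => g (x, y + t • v) - μ / 2 * ∑ j, ((y + t • v) j) ^ 2
  have hφ (t : ℝ) : HasDerivAt φ
      (fderiv ℝ g (x, y + t • v) ((0 : Fin d → ℝ), v) - μ * ((y + t • v) ⬝ᵥ v)) t := by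
    have hsum : HasDerivAt (fun t : ℝ => ∑ j, ((y + t • v) j) ^ 2)
        (∑ j, 2 * ((y + t • v) j * v j)) t := by
      refine HasDerivAt.fun_sum fun j _ => ?_
      have h := (((hasDerivAt_id t).mul_const (v j)).const_add (y j)).pow 2
      convert! h using 1
      simp
      ring
    have h := ((hg _).hasFDerivAt.comp_hasDerivAt t (hasDerivAt_fiber_line x y v t)).sub
      (hsum.const_mul (μ / 2))
    convert! h using 1
    rw [← Finset.mul_sum, dotProduct]
    ring
  have hcφ : ConvexOn ℝ Set.univ φ := by
    have h := hconv.comp_affineMap (AffineMap.lineMap y (y + v) : ℝ →ᵃ[ℝ] Fin p → ℝ)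
    simpa [Function.comp_def, AffineMap.lineMap_apply, φ, add_comm] using h
  have hmono := hcφ.monotoneOn_deriv fun t _ => (hφ t).differentiableAt
  intro s t hst
  simpa [(hφ _).deriv] using hmono (Set.mem_univ s) (Set.mem_univ t) hst

/-- The partial gradient in a strongly convex variable is injective on fibres. -/
theorem gradY_injective_fiber {μ : ℝ} (hμ : 0 < μ) {g : (Fin d → ℝ) × (Fin p → ℝ) → ℝ}
    (hg : Differentiable ℝ g) {x : Fin d → ℝ}
    (hconv : ConvexOn ℝ Set.univ (fun y : Fin p → ℝ => g (x, y) - μ / 2 * ∑ j, (y j) ^ 2)) :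
    Function.Injective fun y => gradY g (x, y) := by
  intro a b hab
  have h := monotone_fderiv_sub_of_convexOn hg hconv a (b - a) zero_le_one
  have hfd : fderiv ℝ g (x, a) ((0 : Fin d → ℝ), b - a)
      = fderiv ℝ g (x, b) ((0 : Fin d → ℝ), b - a) := by
    rw [clm_zero_prod_eq_dotProduct, clm_zero_prod_eq_dotProduct (fderiv ℝ g (x, b))]
    exact congrArg ((b - a) ⬝ᵥ ·) hab
  simp only [zero_smul, add_zero, one_smul, add_sub_cancel, hfd, sub_le_sub_iff_left] at h
  have h' : (b - a) ⬝ᵥ (b - a) ≤ 0 := by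
    rw [sub_dotProduct]
    linarith [le_of_mul_le_mul_left h hμ]
  have h0 : b - a = 0 := by
    refine dotProduct_self_eq_zero.1 (le_antisymm h' ?_)
    exact Finset.sum_nonneg fun j _ => mul_self_nonneg _
  exact (sub_eq_zero.1 h0).symm

theorem mul_dotProduct_self_le_mixedD2 {μ : ℝ} {g : (Fin d → ℝ) × (Fin p → ℝ) → ℝ}
    (hg : ContDiff ℝ 2 g) {x : Fin d → ℝ}
    (hconv : ConvexOn ℝ Set.univ (fun y : Fin p → ℝ => g (x, y) - μ / 2 * ∑ j, (y j) ^ 2))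
    (y v : Fin p → ℝ) :
    μ * (v ⬝ᵥ v) ≤ mixedD2 g (x, y) ((0 : Fin d → ℝ), v) ((0 : Fin d → ℝ), v) := by
  have hmono := monotone_fderiv_sub_of_convexOn (hg.differentiable (by norm_num)) hconv y v
  have h₁ : HasDerivAt (fun t : ℝ => fderiv ℝ g (x, y + t • v) ((0 : Fin d → ℝ), v))
      (mixedD2 g (x, y) ((0 : Fin d → ℝ), v) ((0 : Fin d → ℝ), v)) 0 := by
    have h := (hasFDerivAt_fderiv_apply hg (x, y + (0 : ℝ) • v) (0, v)).comp_hasDerivAt 0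
      (hasDerivAt_fiber_line x y v 0)
    rw [zero_smul, add_zero] at h
    exact h
  have h₂ : HasDerivAt (fun t : ℝ => μ * ((y + t • v) ⬝ᵥ v)) (μ * (v ⬝ᵥ v)) 0 := by
    simp only [add_dotProduct, smul_dotProduct, smul_eq_mul]
    simpa using (((hasDerivAt_id (0 : ℝ)).mul_const (v ⬝ᵥ v)).const_add (y ⬝ᵥ v)).const_mul μ
  have h := hmono.deriv_nonneg (x := 0)
  rw [(h₁.fun_sub h₂).deriv] at h
  linarith

theorem Hblk_posDef {μ : ℝ} (hμ : 0 < μ) {g : (Fin d → ℝ) × (Fin p → ℝ) → ℝ}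
    (hg : ContDiff ℝ 2 g) {x : Fin d → ℝ}
    (hconv : ConvexOn ℝ Set.univ (fun y : Fin p → ℝ => g (x, y) - μ / 2 * ∑ j, (y j) ^ 2))
    (y : Fin p → ℝ) : (Hblk g (x, y)).PosDef := by
  refine .of_dotProduct_mulVec_pos ?_ fun v hv => ?_
  · ext i j
    exact (hg.contDiffAt.isSymmSndFDerivAt (by simp)) _ _
  · rw [star_trivial, ← mixedD2_quadratic_eq]
    refine lt_of_lt_of_le (mul_pos hμ ?_) (mul_dotProduct_self_le_mixedD2 hg hconv y v)
    exact lt_of_le_of_ne (Finset.sum_nonneg fun j _ => mul_self_nonneg _)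
      fun h => hv (dotProduct_self_eq_zero.1 h.symm)

theorem fderiv_gradY_comp_inr_isInvertible {g : (Fin d → ℝ) × (Fin p → ℝ) → ℝ}
    (hg : ContDiff ℝ 2 g) {q : (Fin d → ℝ) × (Fin p → ℝ)} (hH : IsUnit (Hblk g q)) :
    (fderiv ℝ (gradY g) q ∘L .inr ℝ (Fin d → ℝ) (Fin p → ℝ)).IsInvertible := by
  set A := fderiv ℝ (gradY g) q ∘L .inr ℝ (Fin d → ℝ) (Fin p → ℝ)
  have hA (v : Fin p → ℝ) : A v = v ᵥ* Hblk g q := by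
    ext j
    exact (fderiv_gradY_apply hg q _ j).trans (mixedD2_zero_zero_eq g q v j)
  have hinj : Function.Injective (A : (Fin p → ℝ) →ₗ[ℝ] Fin p → ℝ) := fun v w h =>
    vecMul_injective_of_isUnit hH (by simpa [hA] using h)
  exact ⟨(LinearEquiv.ofInjectiveEndo _ hinj).toContinuousLinearEquiv, by ext v; rfl⟩

theorem gradY_eq_zero_of_forall_le {g : (Fin d → ℝ) × (Fin p → ℝ) → ℝ}
    (hg : Differentiable ℝ g) {x : Fin d → ℝ} {y : Fin p → ℝ}
    (hmin : ∀ y', g (x, y) ≤ g (x, y')) : gradY g (x, y) = 0 := by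
  ext j
  have hloc : IsLocalMin (fun t : ℝ => g (x, y + t • (Pi.single j 1 : Fin p → ℝ))) 0 :=
    Filter.Eventually.of_forall fun t => by simpa using hmin _
  have h := hloc.hasDerivAt_eq_zero
    ((hg _).hasFDerivAt.comp_hasDerivAt 0 (hasDerivAt_fiber_line x y (Pi.single j 1) 0))
  simpa [gradY] using h

/-- A zero of `∇_y g` that is unique in each fibre, with invertible Hessian block, depends on the
base point in a `C¹` fashion. -/
theorem contDiff_of_gradY_eq_zero_iff {g : (Fin d → ℝ) × (Fin p → ℝ) → ℝ}
    (hg : ContDiff ℝ 2 g) {Y : (Fin d → ℝ) → Fin p → ℝ}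
    (hY : ∀ x y, gradY g (x, y) = 0 ↔ y = Y x) (hH : ∀ x, IsUnit (Hblk g (x, Y x))) :
    ContDiff ℝ 1 Y := by
  refine contDiff_iff_contDiffAt.2 fun x => ?_
  have hc : ContDiffAt ℝ 1 (gradY g) (x, Y x) := (contDiff_gradY hg).contDiffAt
  have hinv := fderiv_gradY_comp_inr_isInvertible hg (hH x)
  refine (hc.contDiffAt_implicitFunction one_ne_zero hinv).congr_of_eventuallyEq ?_
  filter_upwards [hc.eventually_apply_implicitFunction one_ne_zero hinv] with z hz
  exact ((hY z _).1 (hz.trans ((hY x _).2 rfl))).symm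

theorem Jblk_row_eq_neg_vecMul {g : (Fin d → ℝ) × (Fin p → ℝ) → ℝ}
    (hg : ContDiff ℝ 2 g) {Y : (Fin d → ℝ) → Fin p → ℝ} {x : Fin d → ℝ}
    (hY : ∀ x, gradY g (x, Y x) = 0) (hd : DifferentiableAt ℝ Y x) (i : Fin d) :
    Jblk g (x, Y x) i = -(fderiv ℝ Y x (Pi.single i 1) ᵥ* Hblk g (x, Y x)) := by
  have hF := ((contDiff_gradY hg).differentiable one_ne_zero (x, Y x)).hasFDerivAt
  have h₁ := hF.comp x ((hasFDerivAt_id x).prodMk hd.hasFDerivAt)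
  have h₀ : gradY g ∘ (fun x => (id x, Y x)) = fun _ => 0 := funext hY
  rw [h₀] at h₁
  have h := h₁.unique (hasFDerivAt_const (0 : Fin p → ℝ) x)
  ext j
  have hj := congrFun (DFunLike.congr_fun h (Pi.single i 1)) j
  have hsplit : ((Pi.single i 1, fderiv ℝ Y x (Pi.single i 1)) : (Fin d → ℝ) × (Fin p → ℝ))
      = (Pi.single i 1, 0) + (0, fderiv ℝ Y x (Pi.single i 1)) := by simp
  rw [ContinuousLinearMap.comp_apply, ContinuousLinearMap.prod_apply,
    ContinuousLinearMap.id_apply, hsplit, map_add, Pi.add_apply, fderiv_gradY_apply hg,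
    fderiv_gradY_apply hg, mixedD2_zero_zero_eq] at hj
  exact eq_neg_of_add_eq_zero_left hj

end Helpers

/-- Let `g : ℝ^d × ℝ^p → ℝ` be C², `f : ℝ^d × ℝ^p → ℝ` be C¹, and let
`μ > 0` be such that `y ↦ g(x,y)` is `μ`-strongly convex for every `x`, with unique
minimizer `Y*(x)`. Then (1) `Y*` is C¹, and `H(x) := ∇²_{yy} g(x,Y*(x))` is positive
definite (hence invertible); (2) `Φ(x) := f(x,Y*(x))` is differentiable with
`∇Φ(x) = ∇ₓf(x,Y*(x)) − J(x)[H(x)⁻¹ ∇_y f(x,Y*(x))]`, where `J(x)` is the mixed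
second-derivative block of `g` at `(x,Y*(x))`. -/
theorem stmt14
    (d p : ℕ) (μ : ℝ) (hμ : 0 < μ)
    (g : (Fin d → ℝ) × (Fin p → ℝ) → ℝ) (hg : ContDiff ℝ 2 g)
    (f : (Fin d → ℝ) × (Fin p → ℝ) → ℝ) (hf : ContDiff ℝ 1 f)
    (hconv : ∀ x : Fin d → ℝ, ConvexOn ℝ Set.univ
      (fun y : Fin p → ℝ => g (x, y) - μ / 2 * ∑ j, (y j) ^ 2))
    (Ystar : (Fin d → ℝ) → (Fin p → ℝ))
    (hmin : ∀ x y, g (x, Ystar x) ≤ g (x, y))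
    (huniq : ∀ x y, (∀ y', g (x, y) ≤ g (x, y')) → y = Ystar x) :
    ContDiff ℝ 1 Ystar ∧
    (∀ x, (Hblk g (x, Ystar x)).PosDef) ∧
    (∀ x, IsUnit (Hblk g (x, Ystar x))) ∧
    Differentiable ℝ (fun x => f (x, Ystar x)) ∧
    (∀ x i, fderiv ℝ (fun x' => f (x', Ystar x')) x (Pi.single i 1) =
      fderiv ℝ f (x, Ystar x) (Pi.single i 1, (0 : Fin p → ℝ))
        - (Jblk g (x, Ystar x)).mulVec
            ((Hblk g (x, Ystar x))⁻¹.mulVec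
              (fun j => fderiv ℝ f (x, Ystar x) ((0 : Fin d → ℝ), Pi.single j 1))) i) := by
  have hgd : Differentiable ℝ g := hg.differentiable (by norm_num)
  have hzero (x) : gradY g (x, Ystar x) = 0 := gradY_eq_zero_of_forall_le hgd (hmin x)
  have hiff (x y) : gradY g (x, y) = 0 ↔ y = Ystar x :=
    ⟨fun h => gradY_injective_fiber hμ hgd (hconv x) (h.trans (hzero x).symm),
      fun h => h ▸ hzero x⟩
  have hpos (x) : (Hblk g (x, Ystar x)).PosDef := Hblk_posDef hμ hg (hconv x) _
  have hunit (x) : IsUnit (Hblk g (x, Ystar x)) := (hpos x).isUnit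
  have hYc : ContDiff ℝ 1 Ystar := contDiff_of_gradY_eq_zero_iff hg hiff hunit
  have hYd : Differentiable ℝ Ystar := hYc.differentiable one_ne_zero
  have hΦ (x) := (hf.differentiable one_ne_zero (x, Ystar x)).hasFDerivAt.comp x
    ((hasFDerivAt_id x).prodMk (hYd x).hasFDerivAt)
  refine ⟨hYc, hpos, hunit, fun x => (hΦ x).differentiableAt, fun x i => ?_⟩
  have hdet : IsUnit (Hblk g (x, Ystar x)).det := (isUnit_iff_isUnit_det _).1 (hunit x)
  have hsplit : ((Pi.single i 1, fderiv ℝ Ystar x (Pi.single i 1)) : (Fin d → ℝ) × (Fin p → ℝ))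
      = (Pi.single i 1, 0) + (0, fderiv ℝ Ystar x (Pi.single i 1)) := by simp
  have hfd : fderiv ℝ (fun x' => f (x', Ystar x')) x (Pi.single i 1) =
      fderiv ℝ f (x, Ystar x) (Pi.single i 1, fderiv ℝ Ystar x (Pi.single i 1)) :=
    DFunLike.congr_fun (hΦ x).fderiv (Pi.single i 1)
  rw [hfd, hsplit, map_add, clm_zero_prod_eq_dotProduct, mulVec,
    Jblk_row_eq_neg_vecMul hg hzero (hYd x) i, neg_dotProduct, ← dotProduct_mulVec,
    mulVec_mulVec, mul_nonsing_inv _ hdet, one_mulVec, sub_neg_eq_add]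
end

section
/- Let E be a finite-dimensional real inner product space and let Φ : E → ℝ be differentiable with L-Lipschitz gradient, where L > 0. Then for every x, h ∈ E and every stepsize α with 0 < α ≤ 1/(2L): (α/4)·‖h‖² ≤ Φ(x) − Φ(x − α·h) + (α/2)·‖h − ∇Φ(x)‖². -/
/-- Quadratic upper bound for a function with Lipschitz gradient. -/
theorem le_add_inner_gradient_add_of_lipschitz_gradient
    {E : Type*} [NormedAddCommGroup E] [InnerProductSpace ℝ E] [CompleteSpace E]
    {L : ℝ} {Φ : E → ℝ} (hΦ : Differentiable ℝ Φ)
    (hlip : ∀ x x' : E, ‖gradient Φ x - gradient Φ x'‖ ≤ L * ‖x - x'‖) (x v : E) :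
    Φ (x + v) ≤ Φ x + inner ℝ (gradient Φ x) v + L / 2 * ‖v‖ ^ 2 := by
  have hf (t : ℝ) : HasDerivAt (fun t : ℝ => Φ (x + t • v))
      (inner ℝ (gradient Φ (x + t • v)) v) t := by
    have hline : HasDerivAt (fun t : ℝ => x + t • v) v t := by
      simpa using ((hasDerivAt_id t).smul_const v).const_add x
    simpa [Function.comp_def] using
      ((hΦ (x + t • v)).hasGradientAt.hasFDerivAt).comp_hasDerivAt t hline
  have hB (t : ℝ) : HasDerivAt
      (fun t : ℝ => Φ x + t * inner ℝ (gradient Φ x) v + L / 2 * ‖v‖ ^ 2 * t ^ 2)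
      (inner ℝ (gradient Φ x) v + L * ‖v‖ ^ 2 * t) t := by
    have h := (((hasDerivAt_id t).mul_const (inner ℝ (gradient Φ x) v)).const_add (Φ x)).add
      ((hasDerivAt_pow 2 t).const_mul (L / 2 * ‖v‖ ^ 2))
    refine h.congr_deriv ?_
    push_cast
    ring
  have key := image_le_of_deriv_right_le_deriv_boundary (a := 0) (b := 1)
    (fun t _ => (hf t).continuousAt.continuousWithinAt)
    (fun t _ => (hf t).hasDerivWithinAt) (by simp)
    (fun t _ => (hB t).continuousAt.continuousWithinAt)
    (fun t _ => (hB t).hasDerivWithinAt) (fun t ht => ?_) (Set.right_mem_Icc.2 zero_le_one)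
  · simpa using key
  · have hcs := real_inner_le_norm (gradient Φ (x + t • v) - gradient Φ x) v
    have hL := mul_le_mul_of_nonneg_right (hlip (x + t • v) x) (norm_nonneg v)
    rw [inner_sub_left] at hcs
    rw [add_sub_cancel_left, norm_smul, Real.norm_of_nonneg ht.1] at hL
    linarith

/-- Let `E` be a finite-dimensional real inner product space and
`Φ : E → ℝ` differentiable with `L`-Lipschitz gradient, `L > 0`. Then for every
`x, h ∈ E` and every stepsize `α` with `0 < α ≤ 1/(2L)`:
`(α/4)‖h‖² ≤ Φ(x) − Φ(x − α·h) + (α/2)‖h − ∇Φ(x)‖²`. -/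
theorem stmt17
    {E : Type*} [NormedAddCommGroup E] [InnerProductSpace ℝ E] [FiniteDimensional ℝ E]
    (L : ℝ) (hL : 0 < L)
    (Φ : E → ℝ) (hΦ : Differentiable ℝ Φ)
    (hlip : ∀ x x' : E, ‖gradient Φ x - gradient Φ x'‖ ≤ L * ‖x - x'‖) :
    ∀ (x h : E) (α : ℝ), 0 < α → α ≤ 1 / (2 * L) →
      α / 4 * ‖h‖ ^ 2 ≤ Φ x - Φ (x - α • h) + α / 2 * ‖h - gradient Φ x‖ ^ 2 := by
  intro x h α hα hαL
  have hdesc := le_add_inner_gradient_add_of_lipschitz_gradient hΦ hlip x (-(α • h))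
  rw [← sub_eq_add_neg, inner_neg_right, inner_smul_right, norm_neg, norm_smul,
    Real.norm_of_nonneg hα.le] at hdesc
  rw [norm_sub_sq_real, real_inner_comm]
  have hαL' : α * L ≤ 1 / 2 := by
    rw [le_div_iff₀ (by positivity)] at hαL
    linarith
  have hquad : α * L * (α * ‖h‖ ^ 2) ≤ 1 / 2 * (α * ‖h‖ ^ 2) := by gcongr
  have hg : 0 ≤ α * ‖gradient Φ x‖ ^ 2 := by positivity
  linarith
end

section
/- Let E be a finite-dimensional real inner product space and let Φ : E → ℝ be differentiable with L-Lipschitz gradient (L > 0) and bounded below, with Φ* := inf Φ > −∞. Let (h^k)_{k≥0} be any sequence in E, let (α_k)_{k≥0} satisfy 0 < α_k ≤ 1/(2L) for all k, and define x^{k+1} := x^k − α_k·h^k from an arbitrary x⁰ ∈ E. Then for every integer K ≥ 0: Σ_{k=0}^K α_k·‖h^k‖² ≤ 4·(Φ(x⁰) − Φ*) + 2·Σ_{k=0}^K α_k·‖h^k − ∇Φ(x^k)‖². -/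
/-- The descent lemma: a function with `L`-Lipschitz gradient lies below its quadratic upper
model at every point. -/
theorem le_add_inner_gradient_add_sq {E : Type*} [NormedAddCommGroup E] [InnerProductSpace ℝ E]
    [CompleteSpace E] {L : ℝ} {Φ : E → ℝ} (hΦ : Differentiable ℝ Φ)
    (hlip : ∀ x x' : E, ‖gradient Φ x - gradient Φ x'‖ ≤ L * ‖x - x'‖) (x d : E) :
    Φ (x + d) ≤ Φ x + inner ℝ (gradient Φ x) d + L / 2 * ‖d‖ ^ 2 := by
  have hf (t : ℝ) : HasDerivAt (fun t : ℝ => Φ (x + t • d))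
      (inner ℝ (gradient Φ (x + t • d)) d) t := by
    have hline : HasDerivAt (fun t : ℝ => x + t • d) d t := by
      simpa using ((hasDerivAt_id t).smul_const d).const_add x
    exact (hΦ (x + t • d)).hasGradientAt.hasFDerivAt.comp_hasDerivAt t hline
  have hB (t : ℝ) : HasDerivAt
      (fun t : ℝ => Φ x + t * inner ℝ (gradient Φ x) d + L / 2 * ‖d‖ ^ 2 * t ^ 2)
      (inner ℝ (gradient Φ x) d + L * ‖d‖ ^ 2 * t) t := by
    refine ((((hasDerivAt_id t).mul_const (inner ℝ (gradient Φ x) d)).const_add (Φ x)).add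
      ((hasDerivAt_pow 2 t).const_mul (L / 2 * ‖d‖ ^ 2))).congr_deriv ?_
    norm_num
    ring
  have hbound (t : ℝ) (ht : 0 ≤ t) : inner ℝ (gradient Φ (x + t • d)) d ≤
      inner ℝ (gradient Φ x) d + L * ‖d‖ ^ 2 * t := by
    rw [← sub_le_iff_le_add', ← inner_sub_left]
    calc inner ℝ (gradient Φ (x + t • d) - gradient Φ x) d
        ≤ ‖gradient Φ (x + t • d) - gradient Φ x‖ * ‖d‖ := real_inner_le_norm _ _
      _ ≤ L * ‖x + t • d - x‖ * ‖d‖ := by gcongr; exact hlip _ _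
      _ = L * ‖d‖ ^ 2 * t := by
        rw [add_sub_cancel_left, norm_smul, Real.norm_of_nonneg ht]
        ring
  have key := image_le_of_deriv_right_le_deriv_boundary (a := 0) (b := 1)
    (fun t _ => (hf t).continuousAt.continuousWithinAt) (fun t _ => (hf t).hasDerivWithinAt)
    (by simp) (fun t _ => (hB t).continuousAt.continuousWithinAt)
    (fun t _ => (hB t).hasDerivWithinAt) (fun t ht => hbound t ht.1)
    (Set.right_mem_Icc.2 zero_le_one)
  simpa using key

/-- Per-step decrease of `Φ` along an inexact gradient step with step size at most `1 / (2 * L)`. -/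
theorem mul_sq_norm_le_of_inexact_gradient_step {E : Type*} [NormedAddCommGroup E]
    [InnerProductSpace ℝ E] [CompleteSpace E] {L : ℝ} (hL : 0 < L) {Φ : E → ℝ}
    (hΦ : Differentiable ℝ Φ)
    (hlip : ∀ x x' : E, ‖gradient Φ x - gradient Φ x'‖ ≤ L * ‖x - x'‖)
    {a : ℝ} (ha : 0 ≤ a) (haL : a ≤ 1 / (2 * L)) (x v : E) :
    a * ‖v‖ ^ 2 ≤ 4 * (Φ x - Φ (x - a • v)) + 2 * (a * ‖v - gradient Φ x‖ ^ 2) := by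
  have hdesc := le_add_inner_gradient_add_sq hΦ hlip x (-(a • v))
  rw [← sub_eq_add_neg, inner_neg_right, real_inner_smul_right, norm_neg, norm_smul,
    Real.norm_of_nonneg ha, real_inner_comm] at hdesc
  have haL' : a * (2 * L) ≤ 1 := (le_div_iff₀ (by positivity)).1 haL
  have hquad : a * (2 * L) * (a * ‖v‖ ^ 2) ≤ 1 * (a * ‖v‖ ^ 2) := by gcongr
  have hgrad : 0 ≤ a * ‖gradient Φ x‖ ^ 2 := by positivity
  rw [norm_sub_sq_real]
  linarith

/-- Let `E` be a finite-dimensional real inner product space and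
`Φ : E → ℝ` differentiable with `L`-Lipschitz gradient (`L > 0`) and bounded below with
`Φ* := inf Φ > −∞`. Let `(h^k)` be any sequence in `E`, `0 < α_k ≤ 1/(2L)`, and
`x^{k+1} := x^k − α_k·h^k` from an arbitrary `x⁰`. Then for every `K ≥ 0`:
`Σ_{k=0}^K α_k‖h^k‖² ≤ 4(Φ(x⁰) − Φ*) + 2 Σ_{k=0}^K α_k‖h^k − ∇Φ(x^k)‖²`. -/
theorem stmt18
    {E : Type*} [NormedAddCommGroup E] [InnerProductSpace ℝ E] [FiniteDimensional ℝ E]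
    (L : ℝ) (hL : 0 < L)
    (Φ : E → ℝ) (hΦ : Differentiable ℝ Φ)
    (hlip : ∀ x x' : E, ‖gradient Φ x - gradient Φ x'‖ ≤ L * ‖x - x'‖)
    (hbdd : BddBelow (Set.range Φ))
    (h : ℕ → E) (α : ℕ → ℝ)
    (hα : ∀ k, 0 < α k ∧ α k ≤ 1 / (2 * L))
    (x : ℕ → E)
    (hrec : ∀ k, x (k + 1) = x k - α k • h k) :
    ∀ K : ℕ,
      ∑ k ∈ Finset.range (K + 1), α k * ‖h k‖ ^ 2
        ≤ 4 * (Φ (x 0) - ⨅ x' : E, Φ x')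
          + 2 * ∑ k ∈ Finset.range (K + 1), α k * ‖h k - gradient Φ (x k)‖ ^ 2 := by
  intro K
  have hsum : ∑ k ∈ Finset.range (K + 1), α k * ‖h k‖ ^ 2 ≤
      ∑ k ∈ Finset.range (K + 1), (4 * (Φ (x k) - Φ (x (k + 1))) +
        2 * (α k * ‖h k - gradient Φ (x k)‖ ^ 2)) := by
    refine Finset.sum_le_sum fun k _ => ?_
    rw [hrec k]
    exact mul_sq_norm_le_of_inexact_gradient_step hL hΦ hlip (hα k).1.le (hα k).2 (x k) (h k)
  rw [Finset.sum_add_distrib, ← Finset.mul_sum, ← Finset.mul_sum,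
    Finset.sum_range_sub' (fun k => Φ (x k))] at hsum
  have hinf := ciInf_le hbdd (x (K + 1))
  linarith
end

section
/- Let H := diag(1,2,3) ∈ ℝ^{3×3} and H̄ := diag(39/20, 3, 81/20). Then: (a) for a scaled Haar projector P ∈ ℝ^{3×2} (m = 3, r = 2) with Q := P Pᵀ, one has E[Q H Q] = H̄; (b) H̄⁻¹ e₁ = (20/39)·e₁ whereas H⁻¹ e₁ = e₁, where e₁ = (1,0,0)ᵀ; (c) for the bilevel instance g(x,y) := (1/2)yᵀHy − x·e₁ᵀy and f(x,y) := (1/2)x² + e₁ᵀy on ℝ × ℝ³, the lower-level minimizer is y*(x) = x·e₁, the function Φ(x) := f(x, y*(x)) satisfies Φ'(x) = x + 1, and at x̄ := −e₁ᵀH̄⁻¹e₁ = −20/39 one has Φ'(x̄) = 19/39 ≠ 0. -/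
open MeasureTheory Matrix

section SphereMoments

variable {ν : Measure (Fin 3 → ℝ)}

/-- A finite measure carried by the unit sphere integrates every continuous function. -/
lemma integrable_of_ae_mem_sphere [IsFiniteMeasure ν] (hs : ∀ᵐ u ∂ν, u ⬝ᵥ u = 1)
    {F : (Fin 3 → ℝ) → ℝ} (hF : Continuous F) : Integrable F ν := by
  have hK : IsCompact (Set.Icc (-1 : Fin 3 → ℝ) 1) := isCompact_Icc
  obtain ⟨C, hC⟩ := hK.exists_bound_of_continuousOn hF.continuousOn
  refine Integrable.of_bound hF.aestronglyMeasurable C ?_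
  filter_upwards [hs] with u hu
  refine hC u ?_
  have h : ∀ i, u i ^ 2 ≤ 1 := fun i => by
    rw [← hu, dotProduct, sq]
    exact Finset.single_le_sum (f := fun i => u i * u i) (fun k _ => mul_self_nonneg (u k))
      (Finset.mem_univ i)
  exact ⟨fun i => (abs_le.mp ((sq_le_one_iff_abs_le_one _).mp (h i))).1,
    fun i => (abs_le.mp ((sq_le_one_iff_abs_le_one _).mp (h i))).2⟩

lemma integral_comp_mulVec_of_invariant
    (hinv : ∀ g : Matrix (Fin 3) (Fin 3) ℝ, gᵀ * g = 1 → ν.map g.mulVec = ν)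
    {g : Matrix (Fin 3) (Fin 3) ℝ} (hg : gᵀ * g = 1) {F : (Fin 3 → ℝ) → ℝ} (hF : Continuous F) :
    ∫ u, F (g.mulVec u) ∂ν = ∫ u, F u ∂ν := by
  conv_rhs => rw [← hinv g hg]
  refine (integral_map ?_ hF.aestronglyMeasurable).symm
  exact (Continuous.matrix_mulVec continuous_const continuous_id).aemeasurable

/-- Functions that are odd in one coordinate have mean zero. -/
lemma integral_eq_zero_of_odd
    (hinv : ∀ g : Matrix (Fin 3) (Fin 3) ℝ, gᵀ * g = 1 → ν.map g.mulVec = ν)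
    (i : Fin 3) {F : (Fin 3 → ℝ) → ℝ} (hF : Continuous F)
    (hodd : ∀ u, F (fun k => if k = i then -u k else u k) = -F u) : ∫ u, F u ∂ν = 0 := by
  have hg : (diagonal fun k => if k = i then (-1 : ℝ) else 1)ᵀ *
      (diagonal fun k => if k = i then (-1 : ℝ) else 1) = 1 := by
    rw [diagonal_transpose, diagonal_mul_diagonal, ← diagonal_one]
    congr 1
    ext k
    split_ifs <;> norm_num
  have h := integral_comp_mulVec_of_invariant hinv hg hF
  have hmul : ∀ u : Fin 3 → ℝ, (diagonal fun k => if k = i then (-1 : ℝ) else 1).mulVec u =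
      fun k => if k = i then -u k else u k := fun u => by
    ext k
    rw [mulVec_diagonal]
    split_ifs <;> ring
  simp_rw [hmul, hodd, integral_neg] at h
  linarith

lemma exists_orthogonal_three_four_five {i j : Fin 3} (hij : i ≠ j) :
    ∃ g : Matrix (Fin 3) (Fin 3) ℝ, gᵀ * g = 1 ∧
      ∀ u, g.mulVec u i = 3 / 5 * u i + 4 / 5 * u j := by
  set w : Fin 3 → ℝ := Pi.single i 1 - (2 : ℝ) • Pi.single j 1 with hw
  have hww : w ⬝ᵥ w = 5 := by
    simp [hw, hij, hij.symm]
    norm_num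
  refine ⟨1 - (2 / 5 : ℝ) • vecMulVec w w, ?_, fun u => ?_⟩
  · rw [transpose_sub, transpose_one, transpose_smul, transpose_vecMulVec, Matrix.sub_mul,
      Matrix.one_mul, Matrix.mul_sub, Matrix.mul_one, smul_mul, Matrix.mul_smul,
      vecMulVec_mul_vecMulVec, hww]
    ext k l
    simp only [Matrix.sub_apply, Matrix.smul_apply, vecMulVec_apply, Pi.smul_apply, smul_eq_mul]
    ring
  · have hwu : w ⬝ᵥ u = u i - 2 * u j := by simp [hw, sub_dotProduct]
    have hwi : w i = 1 := by simp [hw, hij]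
    simp only [sub_mulVec, smul_mulVec, one_mulVec, vecMulVec_mulVec, hwu, Pi.sub_apply,
      Pi.smul_apply, hwi, smul_eq_mul, MulOpposite.smul_eq_mul_unop, MulOpposite.unop_op]
    ring

lemma integral_pow_four_relation [IsFiniteMeasure ν] (hs : ∀ᵐ u ∂ν, u ⬝ᵥ u = 1)
    (hinv : ∀ g : Matrix (Fin 3) (Fin 3) ℝ, gᵀ * g = 1 → ν.map g.mulVec = ν)
    {i j : Fin 3} (hij : i ≠ j) :
    544 * ∫ u, u i ^ 4 ∂ν = 256 * ∫ u, u j ^ 4 ∂ν + 864 * ∫ u, u i ^ 2 * u j ^ 2 ∂ν := by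
  obtain ⟨g, hg, hgi⟩ := exists_orthogonal_three_four_five hij
  have h := integral_comp_mulVec_of_invariant hinv hg (F := fun u => u i ^ 4) (by fun_prop)
  have h31 : ∫ u, u i ^ 3 * u j ∂ν = 0 :=
    integral_eq_zero_of_odd hinv j (by fun_prop) fun u => by simp [hij]
  have h13 : ∫ u, u i * u j ^ 3 ∂ν = 0 :=
    integral_eq_zero_of_odd hinv i (by fun_prop) fun u => by simp [hij.symm]
  have hexp : ∀ u : Fin 3 → ℝ, g.mulVec u i ^ 4 = 81 / 625 * u i ^ 4 + 256 / 625 * u j ^ 4 +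
      864 / 625 * (u i ^ 2 * u j ^ 2) + 432 / 625 * (u i ^ 3 * u j) +
      768 / 625 * (u i * u j ^ 3) := fun u => by
    rw [hgi]
    ring
  simp_rw [hexp] at h
  have hI {F : (Fin 3 → ℝ) → ℝ} (hF : Continuous F) := integrable_of_ae_mem_sphere hs hF
  rw [integral_add (hI (by fun_prop)) (hI (by fun_prop)),
    integral_add (hI (by fun_prop)) (hI (by fun_prop)),
    integral_add (hI (by fun_prop)) (hI (by fun_prop)),
    integral_add (hI (by fun_prop)) (hI (by fun_prop))] at h
  simp only [integral_const_mul, h31, h13] at h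
  linarith

lemma integral_pow_four_eq [IsFiniteMeasure ν] (hs : ∀ᵐ u ∂ν, u ⬝ᵥ u = 1)
    (hinv : ∀ g : Matrix (Fin 3) (Fin 3) ℝ, gᵀ * g = 1 → ν.map g.mulVec = ν)
    {i j : Fin 3} (hij : i ≠ j) :
    ∫ u, u i ^ 4 ∂ν = 3 * ∫ u, u i ^ 2 * u j ^ 2 ∂ν := by
  have h₁ := integral_pow_four_relation hs hinv hij
  have h₂ := integral_pow_four_relation hs hinv hij.symm
  simp_rw [mul_comm (_ ^ 2 : ℝ) (_ ^ 2)] at h₁ h₂ ⊢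
  have h₃ : ∫ u, u i ^ 2 * u j ^ 2 ∂ν = ∫ u, u j ^ 2 * u i ^ 2 ∂ν := by
    simp_rw [mul_comm]
  linarith

/-- Fourth moments of the uniform distribution on the two-dimensional sphere. -/
lemma integral_sq_mul_sq [IsProbabilityMeasure ν] (hs : ∀ᵐ u ∂ν, u ⬝ᵥ u = 1)
    (hinv : ∀ g : Matrix (Fin 3) (Fin 3) ℝ, gᵀ * g = 1 → ν.map g.mulVec = ν) (i j : Fin 3) :
    ∫ u, u i ^ 2 * u j ^ 2 ∂ν = if i = j then 1 / 5 else 1 / 15 := by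
  have hI {F : (Fin 3 → ℝ) → ℝ} (hF : Continuous F) := integrable_of_ae_mem_sphere hs hF
  have hsum : ∑ k, ∑ l, ∫ u, u k ^ 2 * u l ^ 2 ∂ν = 1 := by
    have hone : ∫ u, ∑ k, ∑ l, u k ^ 2 * u l ^ 2 ∂ν = 1 := by
      calc ∫ u, ∑ k, ∑ l, u k ^ 2 * u l ^ 2 ∂ν = ∫ _, (1 : ℝ) ∂ν := by
            refine integral_congr_ae ?_
            filter_upwards [hs] with u hu
            rw [← Finset.sum_mul_sum]
            simp only [dotProduct, ← sq] at hu
            rw [hu, one_mul]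
        _ = 1 := by simp
    rw [← hone, integral_finsetSum _ fun k _ => hI (by fun_prop)]
    exact Finset.sum_congr rfl fun k _ =>
      (integral_finsetSum _ fun l _ => hI (by fun_prop)).symm
  have hdiag : ∀ k, ∫ u, u k ^ 2 * u k ^ 2 ∂ν = ∫ u, u k ^ 4 ∂ν := fun k => by
    refine integral_congr_ae (.of_forall fun u => ?_)
    ring
  have h01 := integral_pow_four_eq hs hinv (i := 0) (j := 1) (by decide)
  have h02 := integral_pow_four_eq hs hinv (i := 0) (j := 2) (by decide)
  have h10 := integral_pow_four_eq hs hinv (i := 1) (j := 0) (by decide)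
  have h12 := integral_pow_four_eq hs hinv (i := 1) (j := 2) (by decide)
  have h20 := integral_pow_four_eq hs hinv (i := 2) (j := 0) (by decide)
  have h21 := integral_pow_four_eq hs hinv (i := 2) (j := 1) (by decide)
  have hcomm : ∀ k l, ∫ u, u k ^ 2 * u l ^ 2 ∂ν = ∫ u, u l ^ 2 * u k ^ 2 ∂ν := fun k l =>
    integral_congr_ae (.of_forall fun u => mul_comm _ _)
  have c01 := hcomm 0 1
  have c02 := hcomm 0 2
  have c12 := hcomm 1 2
  simp only [Fin.sum_univ_three, hdiag] at hsum
  fin_cases i <;> fin_cases j <;> simp [hdiag] <;> linarith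

/-- The mean of `(1 - u uᵀ) diag(h) (1 - u uᵀ)` for `u` uniform on the sphere. -/
lemma integral_projected_diagonal [IsProbabilityMeasure ν] (hs : ∀ᵐ u ∂ν, u ⬝ᵥ u = 1)
    (hinv : ∀ g : Matrix (Fin 3) (Fin 3) ℝ, gᵀ * g = 1 → ν.map g.mulVec = ν)
    (h : Fin 3 → ℝ) (i j : Fin 3) :
    ∫ u, ((1 - vecMulVec u u) * diagonal h * (1 - vecMulVec u u)) i j ∂ν =
      if i = j then (7 * h i + ∑ k, h k) / 15 else 0 := by
  have hI {F : (Fin 3 → ℝ) → ℝ} (hF : Continuous F) := integrable_of_ae_mem_sphere hs hF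
  have hentry : ∀ u : Fin 3 → ℝ,
      ((1 - vecMulVec u u) * diagonal h * (1 - vecMulVec u u)) i j =
        (if i = j then h i else 0) - (h i + h j) * (u i * u j) +
          ∑ k, h k * (u i * u j * u k ^ 2) := fun u => by
    rw [Matrix.mul_apply]
    simp only [mul_diagonal, Matrix.sub_apply, vecMulVec_apply, one_apply, Fin.sum_univ_three]
    fin_cases i <;> fin_cases j <;> simp <;> ring
  simp_rw [hentry]
  split_ifs with hij
  · subst hij
    have hae : ∀ᵐ u ∂ν, h i - (h i + h i) * (u i * u i) + ∑ k, h k * (u i * u i * u k ^ 2) =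
        h i + ∑ k, (h k - 2 * h i) * (u i ^ 2 * u k ^ 2) := by
      filter_upwards [hs] with u hu
      simp only [dotProduct, Fin.sum_univ_three] at hu ⊢
      linear_combination 2 * h i * u i ^ 2 * hu
    rw [integral_congr_ae hae, integral_add (hI (by fun_prop)) (hI (by fun_prop)),
      integral_finsetSum _ fun k _ => hI (by fun_prop)]
    simp only [integral_const_mul, integral_sq_mul_sq hs hinv, integral_const, probReal_univ,
      one_smul, Fin.sum_univ_three]
    fin_cases i <;> simp <;> ring
  · refine integral_eq_zero_of_odd hinv i (by fun_prop) fun u => ?_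
    fin_cases i <;> fin_cases j <;> first | exact absurd rfl hij | skip
    all_goals simp [Fin.sum_univ_three]
    all_goals ring

end SphereMoments

lemma scaled_projector_eq {O : Matrix (Fin 3) (Fin 3) ℝ} (hO : Oᵀ * O = 1)
    {P : Matrix (Fin 3) (Fin 2) ℝ}
    (hP : P = Real.sqrt ((3 : ℝ) / 2) •
      O.submatrix id (Fin.castLE (by norm_num : (2 : ℕ) ≤ 3))) :
    P * Pᵀ = (3 / 2 : ℝ) • (1 - vecMulVec (O.col 2) (O.col 2)) := by
  have hO' : O * Oᵀ = 1 := mul_eq_one_comm.mp hO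
  ext i j
  have hij := congrFun (congrFun hO' i) j
  simp only [Matrix.mul_apply, Fin.sum_univ_three, transpose_apply] at hij
  have h32 : Real.sqrt (3 / 2) * Real.sqrt (3 / 2) = 3 / 2 :=
    Real.mul_self_sqrt (by norm_num)
  rw [hP, Matrix.smul_apply, Matrix.sub_apply, ← hij, vecMulVec_apply, Matrix.mul_apply, Fin.sum_univ_two]
  simp only [Matrix.smul_apply, transpose_apply, submatrix_apply, id, smul_eq_mul, col_apply,
    show Fin.castLE (by norm_num : (2 : ℕ) ≤ 3) 0 = 0 from rfl,
    show Fin.castLE (by norm_num : (2 : ℕ) ≤ 3) 1 = 1 from rfl]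
  linear_combination (O i 0 * O j 0 + O i 1 * O j 1) * h32

lemma measurable_matrix_col {m n : ℕ} (k : Fin n) :
    Measurable fun A : Matrix (Fin m) (Fin n) ℝ => A.col k :=
  measurable_pi_lambda _ fun i => (measurable_pi_apply k).comp (measurable_pi_apply i)

lemma measurable_const_matrix_mul {l m n : ℕ} (g : Matrix (Fin l) (Fin m) ℝ) :
    Measurable fun A : Matrix (Fin m) (Fin n) ℝ => g * A := by
  refine measurable_pi_lambda _ fun i => measurable_pi_lambda _ fun j => ?_
  simp only [Matrix.mul_apply]
  exact Finset.measurable_fun_sum _ fun k _ => measurable_const.mul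
    ((measurable_pi_apply j).comp (measurable_pi_apply k))

lemma inv_diagonal_mulVec {h : Fin 3 → ℝ} (hh : ∀ i, h i ≠ 0) (v : Fin 3 → ℝ) :
    (diagonal h)⁻¹.mulVec v = fun i => (h i)⁻¹ * v i := by
  have hinv : (diagonal h)⁻¹ = diagonal fun i => (h i)⁻¹ := by
    refine inv_eq_right_inv ?_
    rw [diagonal_mul_diagonal, ← diagonal_one]
    congr 1
    ext i
    exact mul_inv_cancel₀ (hh i)
  ext i
  rw [hinv, mulVec_diagonal]

/-- Let `H := diag(1,2,3)` and `H̄ := diag(39/20, 3, 81/20)`. Then: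
(a) for a scaled Haar projector `P ∈ ℝ^{3×2}` with `Q := P Pᵀ`, `E[Q H Q] = H̄`;
(b) `H̄⁻¹e₁ = (20/39)e₁` whereas `H⁻¹e₁ = e₁`;
(c) for `g(x,y) := (1/2)yᵀHy − x·e₁ᵀy` and `f(x,y) := (1/2)x² + e₁ᵀy`, the lower-level
minimizer is `y*(x) = x·e₁` (the unique minimizer of `y ↦ g(x,y)`),
`Φ(x) := f(x, y*(x))` satisfies `Φ'(x) = x + 1`, and at
`x̄ := −e₁ᵀH̄⁻¹e₁ = −20/39` one has `Φ'(x̄) = 19/39 ≠ 0`. -/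
theorem stmt19
    {Ω : Type} [MeasurableSpace Ω] (μ : Measure Ω) [IsProbabilityMeasure μ]
    (O : Ω → Matrix (Fin 3) (Fin 3) ℝ) (hOmeas : Measurable O)
    (hOorth : ∀ᵐ ω ∂μ, (O ω)ᵀ * O ω = 1)
    (hOhaar : ∀ g : Matrix (Fin 3) (Fin 3) ℝ, gᵀ * g = 1 →
      Measure.map (fun ω => g * O ω) μ = Measure.map O μ)
    (P : Ω → Matrix (Fin 3) (Fin 2) ℝ)
    (hP : ∀ ω, P ω = Real.sqrt ((3 : ℝ) / 2) •
      (O ω).submatrix id (Fin.castLE (by norm_num : (2 : ℕ) ≤ 3)))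
    (Q : Ω → Matrix (Fin 3) (Fin 3) ℝ)
    (hQ : ∀ ω, Q ω = P ω * (P ω)ᵀ)
    (H Hbar : Matrix (Fin 3) (Fin 3) ℝ)
    (hH : H = Matrix.diagonal ![1, 2, 3])
    (hHbar : Hbar = Matrix.diagonal ![39 / 20, 3, 81 / 20])
    (e₁ : Fin 3 → ℝ) (he₁ : e₁ = ![1, 0, 0])
    (g : ℝ × (Fin 3 → ℝ) → ℝ)
    (hg : ∀ x y, g (x, y) = (1 / 2) * (y ⬝ᵥ H.mulVec y) - x * (e₁ ⬝ᵥ y))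
    (f : ℝ × (Fin 3 → ℝ) → ℝ)
    (hf : ∀ x y, f (x, y) = (1 / 2) * x ^ 2 + e₁ ⬝ᵥ y)
    (Φ : ℝ → ℝ) (hΦ : ∀ x, Φ x = f (x, x • e₁)) :
    (∀ i j, ∫ ω, (Q ω * H * Q ω) i j ∂μ = Hbar i j) ∧
    (Hbar⁻¹.mulVec e₁ = (20 / 39 : ℝ) • e₁) ∧
    (H⁻¹.mulVec e₁ = e₁) ∧
    (∀ x y, y ≠ x • e₁ → g (x, x • e₁) < g (x, y)) ∧
    (∀ x, deriv Φ x = x + 1) ∧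
    (e₁ ⬝ᵥ Hbar⁻¹.mulVec e₁ = 20 / 39) ∧
    (deriv Φ (-(20 / 39)) = 19 / 39) ∧
    ((19 : ℝ) / 39 ≠ 0) := by
  have hderiv : ∀ x, deriv Φ x = x + 1 := fun x => by
    have hΦ' : Φ = fun x => 1 / 2 * x ^ 2 + x := by
      ext x
      simp [hΦ, hf, he₁, dotProduct, Fin.sum_univ_three]
    rw [hΦ']
    have h := ((hasDerivAt_pow 2 x).const_mul (1 / 2 : ℝ)).add (hasDerivAt_id x)
    refine h.deriv.trans ?_
    norm_num
    ring
  have hHbar_inv : Hbar⁻¹.mulVec e₁ = (20 / 39 : ℝ) • e₁ := by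
    rw [hHbar, inv_diagonal_mulVec (by intro i; fin_cases i <;> norm_num), he₁]
    ext i
    fin_cases i <;> norm_num
  refine ⟨fun i j => ?_, hHbar_inv, ?_, fun x y hy => ?_, hderiv, ?_, ?_, by norm_num⟩
  · have hcol : Measurable fun ω => (O ω).col 2 := (measurable_matrix_col 2).comp hOmeas
    set ν := μ.map fun ω => (O ω).col 2 with hν
    have : IsProbabilityMeasure ν := Measure.isProbabilityMeasure_map hcol.aemeasurable
    have hs : ∀ᵐ u ∂ν, u ⬝ᵥ u = 1 := by
      refine (ae_map_iff hcol.aemeasurable ?_).mpr ?_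
      · exact measurableSet_eq_fun (by unfold dotProduct; fun_prop) measurable_const
      · filter_upwards [hOorth] with ω hω
        exact congrFun (congrFun hω 2) 2
    have hinv : ∀ g : Matrix (Fin 3) (Fin 3) ℝ, gᵀ * g = 1 → ν.map g.mulVec = ν := fun g hg => by
      have hgm : Measurable g.mulVec :=
        (Continuous.matrix_mulVec continuous_const continuous_id).measurable
      have h := congrArg (Measure.map fun A => A.col 2) (hOhaar g hg)
      have hgO : Measurable fun ω => g * O ω := (measurable_const_matrix_mul g).comp hOmeas
      rw [Measure.map_map (measurable_matrix_col 2) hgO, Measure.map_map (measurable_matrix_col 2) hOmeas] at h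
      rw [hν, Measure.map_map hgm hcol]
      exact h
    have hQae : ∀ᵐ ω ∂μ, (Q ω * H * Q ω) i j = 9 / 4 *
        ((1 - vecMulVec ((O ω).col 2) ((O ω).col 2)) * diagonal ![(1 : ℝ), 2, 3] *
          (1 - vecMulVec ((O ω).col 2) ((O ω).col 2))) i j := by
      filter_upwards [hOorth] with ω hω
      rw [hQ, scaled_projector_eq hω (hP ω), hH, smul_mul, smul_mul, Matrix.mul_smul, smul_smul,
        Matrix.smul_apply, smul_eq_mul]
      norm_num
    have hcont : Continuous fun u : Fin 3 → ℝ =>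
        ((1 - vecMulVec u u) * diagonal ![(1 : ℝ), 2, 3] * (1 - vecMulVec u u)) i j := by
      refine Continuous.matrix_elem ?_ i j
      fun_prop
    have hsum : ∑ k, ![(1 : ℝ), 2, 3] k = 6 := by
      rw [Fin.sum_univ_three]
      change (1 : ℝ) + 2 + 3 = 6
      norm_num
    rw [integral_congr_ae hQae, integral_const_mul,
      ← integral_map hcol.aemeasurable hcont.aestronglyMeasurable,
      integral_projected_diagonal hs hinv, hsum, hHbar]
    fin_cases i <;> fin_cases j <;> norm_num
  · rw [hH, inv_diagonal_mulVec (by intro i; fin_cases i <;> norm_num), he₁]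
    ext i
    fin_cases i <;> norm_num
  · have hgap : g (x, y) - g (x, x • e₁) =
        1 / 2 * ((y 0 - x) ^ 2 + 2 * y 1 ^ 2 + 3 * y 2 ^ 2) := by
      simp [hg, hH, he₁, mulVec_diagonal, dotProduct, Fin.sum_univ_three]
      ring
    by_contra! hle
    have h0 : y 0 = x := by nlinarith [sq_nonneg (y 0 - x), sq_nonneg (y 1), sq_nonneg (y 2)]
    have h1 : y 1 = 0 := by nlinarith [sq_nonneg (y 0 - x), sq_nonneg (y 1), sq_nonneg (y 2)]
    have h2 : y 2 = 0 := by nlinarith [sq_nonneg (y 0 - x), sq_nonneg (y 1), sq_nonneg (y 2)]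
    refine hy ?_
    ext i
    fin_cases i <;> simp [h0, h1, h2, he₁]
  · rw [hHbar_inv, he₁]
    simp [dotProduct, Fin.sum_univ_three]
  · rw [hderiv]
    norm_num
end
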